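/- Let n ≥ 2, α ∈ ℝ, and let Σ be a domain in S^{n−1}. For u ∈ C²_c(C̄_Σ∖{0}), define w : ℝ × Σ → ℝ by u(x) = |x|^{(4−n−α)/2} w(−log|x|, x/|x|). Then on the cylinder Z_Σ := ℝ × Σ one has ∫_{C_Σ} |x|^{α−4} |u|² dx = ∫_{Z_Σ} |w|² ds dσ and ∫_{C_Σ} |x|^α |Δu|² dx = ∫_{Z_Σ} |−Δ_σ w + γ_{n,α} w|² ds dσ + ∫_{Z_Σ} ( |w_ss|² + 2|∇_σ w_s|² + 2 γ̄_{n,α} |w_s|² ) ds dσ, where w_s, w_ss denote partial derivatives in the variable s ∈ ℝ and ∇_σ, Δ_σ denote the spherical gradient and Laplace–Beltrami operator. -/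

import Mathlib

open MeasureTheory Metric Set Filter
open scoped RealInnerProductSpace

noncomputable section

/-- The Euclidean Laplacian of `u : ℝⁿ → ℝ` at a point. -/
def lap {n : ℕ} (u : EuclideanSpace ℝ (Fin n) → ℝ) (x : EuclideanSpace ℝ (Fin n)) : ℝ :=
  ∑ i : Fin n, iteratedFDeriv ℝ 2 u x ![EuclideanSpace.single i 1, EuclideanSpace.single i 1]

/-- The Laplace–Beltrami operator on the unit sphere, computed via the
`0`-homogeneous extension: for a `0`-homogeneous function the Euclidean Laplacian
restricted to the unit sphere is exactly the Laplace–Beltrami operator. -/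
def sphLap {n : ℕ} (φ : EuclideanSpace ℝ (Fin n) → ℝ) (σ : EuclideanSpace ℝ (Fin n)) : ℝ :=
  lap (fun x => φ (‖x‖⁻¹ • x)) σ

/-- Squared norm of the spherical gradient, via the `0`-homogeneous extension. -/
def sphGradNormSq {n : ℕ} (φ : EuclideanSpace ℝ (Fin n) → ℝ) (σ : EuclideanSpace ℝ (Fin n)) : ℝ :=
  ‖fderiv ℝ (fun x => φ (‖x‖⁻¹ • x)) σ‖ ^ 2

/-- The open cone `C_Σ = {rσ : r > 0, σ ∈ Σ}` over a subset of the unit sphere. -/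
def coneOf {n : ℕ} (S : Set (EuclideanSpace ℝ (Fin n))) : Set (EuclideanSpace ℝ (Fin n)) :=
  {x | x ≠ 0 ∧ ‖x‖⁻¹ • x ∈ S}

/-- The canonical surface measure `dσ` on the unit sphere of `ℝⁿ`, as a measure on `ℝⁿ`. -/
def sphMeasure (n : ℕ) : Measure (EuclideanSpace ℝ (Fin n)) :=
  Measure.map Subtype.val
    ((volume : Measure (EuclideanSpace ℝ (Fin n))).toSphere)

/-- A (Dirichlet) eigenfunction of the Laplace–Beltrami operator on `S ⊆ 𝕊^{n-1}`
relative to the eigenvalue `lam`. -/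
def IsEigenfun {n : ℕ} (S : Set (EuclideanSpace ℝ (Fin n))) (lam : ℝ)
    (φ : EuclideanSpace ℝ (Fin n) → ℝ) : Prop :=
  ContinuousOn (fun x => φ (‖x‖⁻¹ • x)) (coneOf (closure S)) ∧
  ContDiffOn ℝ 2 (fun x => φ (‖x‖⁻¹ • x)) (coneOf S) ∧
  (∀ σ ∈ closure S \ S, φ σ = 0) ∧
  (∃ σ ∈ S, φ σ ≠ 0) ∧
  (∀ σ ∈ S, - sphLap φ σ = lam * φ σ)

/-- The Dirichlet spectrum `Λ(Σ)` of the Laplace–Beltrami operator on `S`. -/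
def spec {n : ℕ} (S : Set (EuclideanSpace ℝ (Fin n))) : Set ℝ :=
  {lam | ∃ φ, IsEigenfun S lam φ}

/-- `S` is a domain in the unit sphere `𝕊^{n-1}`: a relatively open connected
nonempty subset. -/
def IsSphDomain {n : ℕ} (S : Set (EuclideanSpace ℝ (Fin n))) : Prop :=
  S ⊆ Metric.sphere (0 : EuclideanSpace ℝ (Fin n)) 1 ∧
  IsOpen (Subtype.val ⁻¹' S : Set (Metric.sphere (0 : EuclideanSpace ℝ (Fin n)) 1)) ∧
  IsConnected S

/-- `S` is a domain of class `C²` in the unit sphere: a domain such that the cone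
over it admits local `C²` defining functions away from the origin. -/
def IsC2SphDomain {n : ℕ} (S : Set (EuclideanSpace ℝ (Fin n))) : Prop :=
  IsSphDomain S ∧
  ∀ x ∈ frontier (coneOf S) \ {0}, ∃ (U : Set (EuclideanSpace ℝ (Fin n)))
    (f : EuclideanSpace ℝ (Fin n) → ℝ), IsOpen U ∧ x ∈ U ∧ ContDiff ℝ 2 f ∧
    fderiv ℝ f x ≠ 0 ∧ coneOf S ∩ U = {y ∈ U | f y < 0}

/-- `γ_{n,α} = ((n-2)/2)² - ((α-2)/2)²`. -/
def gam (n : ℕ) (α : ℝ) : ℝ := (((n : ℝ) - 2) / 2) ^ 2 - ((α - 2) / 2) ^ 2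

/-- `γ̄_{n,α} = ((n-2)/2)² + ((α-2)/2)²`. -/
def gbar (n : ℕ) (α : ℝ) : ℝ := (((n : ℝ) - 2) / 2) ^ 2 + ((α - 2) / 2) ^ 2

/-- The class `C²_c(Ω̄ ∖ {0})` of Navier test functions: `C²` up to the closure of
`Ω`, vanishing on `∂Ω` and in a neighborhood of `0` and of `∞`. -/
def NavierAdm {n : ℕ} (Ω : Set (EuclideanSpace ℝ (Fin n)))
    (u : EuclideanSpace ℝ (Fin n) → ℝ) : Prop :=
  ContDiffOn ℝ 2 u (closure Ω) ∧
  (∀ x ∈ frontier Ω, u x = 0) ∧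
  (∃ ε > 0, ∀ x : EuclideanSpace ℝ (Fin n), ‖x‖ < ε → u x = 0) ∧
  (∃ R : ℝ, ∀ x : EuclideanSpace ℝ (Fin n), R < ‖x‖ → u x = 0)

/-- The class `C²_c(Ω)` of Dirichlet test functions: globally `C²` with compact
support contained in `Ω`. -/
def DirichletAdm {n : ℕ} (Ω : Set (EuclideanSpace ℝ (Fin n)))
    (u : EuclideanSpace ℝ (Fin n) → ℝ) : Prop :=
  ContDiff ℝ 2 u ∧ HasCompactSupport u ∧ tsupport u ⊆ Ω

/-- The best Rellich constant `μ_N(Ω;α)` under Navier boundary conditions. -/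
def muN {n : ℕ} (Ω : Set (EuclideanSpace ℝ (Fin n))) (α : ℝ) : ℝ :=
  sInf {q : ℝ | ∃ u, NavierAdm Ω u ∧ (∃ x ∈ Ω, u x ≠ 0) ∧
    q = (∫ x in Ω, ‖x‖ ^ α * (lap u x) ^ 2) / (∫ x in Ω, ‖x‖ ^ (α - 4) * (u x) ^ 2)}

/-- The best Rellich constant `μ_D(Ω;α)` under Dirichlet boundary conditions. -/
def muD {n : ℕ} (Ω : Set (EuclideanSpace ℝ (Fin n))) (α : ℝ) : ℝ :=
  sInf {q : ℝ | ∃ u, DirichletAdm Ω u ∧ (∃ x ∈ Ω, u x ≠ 0) ∧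
    q = (∫ x in Ω, ‖x‖ ^ α * (lap u x) ^ 2) / (∫ x in Ω, ‖x‖ ^ (α - 4) * (u x) ^ 2)}

/-- The surrogate of `H² ∩ H¹₀(Σ)`: functions whose `0`-homogeneous extension is
`C²` up to the closure of the cone, vanishing on the relative boundary of `S`. -/
def NavAdmS {n : ℕ} (S : Set (EuclideanSpace ℝ (Fin n)))
    (φ : EuclideanSpace ℝ (Fin n) → ℝ) : Prop :=
  ContDiffOn ℝ 2 (fun x => φ (‖x‖⁻¹ • x)) (coneOf (closure S)) ∧
  (∀ σ ∈ closure S \ S, φ σ = 0)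

/-- The surrogate of `H²₀(Σ)`: as `NavAdmS`, with in addition vanishing gradient
on the relative boundary of `S`. -/
def DirAdmS {n : ℕ} (S : Set (EuclideanSpace ℝ (Fin n)))
    (φ : EuclideanSpace ℝ (Fin n) → ℝ) : Prop :=
  NavAdmS S φ ∧
  ∀ σ ∈ closure S \ S,
    fderivWithin ℝ (fun x => φ (‖x‖⁻¹ • x)) (coneOf (closure S)) σ = 0

/-- The Rayleigh-type quotient `∫_Σ |Lφ|² dσ / ∫_Σ |φ|² dσ` with
`Lφ = -Δ_σ φ + γ φ`. -/
def sphQuot {n : ℕ} (S : Set (EuclideanSpace ℝ (Fin n))) (γ : ℝ)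
    (φ : EuclideanSpace ℝ (Fin n) → ℝ) : ℝ :=
  (∫ σ in S, (- sphLap φ σ + γ * φ σ) ^ 2 ∂(sphMeasure n)) /
    (∫ σ in S, (φ σ) ^ 2 ∂(sphMeasure n))

/-- Partial derivative `w_s` of a function on the cylinder `ℝ × 𝕊^{n-1}`. -/
def ws {n : ℕ} (w : ℝ × EuclideanSpace ℝ (Fin n) → ℝ)
    (p : ℝ × EuclideanSpace ℝ (Fin n)) : ℝ :=
  deriv (fun t => w (t, p.2)) p.1

/-- Second partial derivative `w_ss` of a function on the cylinder. -/
def wss {n : ℕ} (w : ℝ × EuclideanSpace ℝ (Fin n) → ℝ)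
    (p : ℝ × EuclideanSpace ℝ (Fin n)) : ℝ :=
  deriv (fun t => ws w (t, p.2)) p.1

end


open MeasureTheory Metric Set Filter
open scoped RealInnerProductSpace Topology

/-- the parametrisation of the half-line -/
noncomputable def expNeg (s : ℝ) : Ioi (0 : ℝ) := ⟨Real.exp (-s), Real.exp_pos _⟩

theorem expNeg_measurableEmbedding : MeasurableEmbedding expNeg := by
  have : PolishSpace (Ioi (0:ℝ)) := isOpen_Ioi.polishSpace
  apply Continuous.measurableEmbedding
  · exact Continuous.subtype_mk (by fun_prop) _
  · intro a b hab
    have := congrArg Subtype.val hab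
    simpa [expNeg] using this

theorem lintegral_expNeg (f : ℝ → ENNReal) :
    ∫⁻ r in Ioi (0:ℝ), f r = ∫⁻ s : ℝ, ENNReal.ofReal (Real.exp (-s)) * f (Real.exp (-s)) := by
  have h := lintegral_image_eq_lintegral_abs_deriv_mul (s := univ) (f := fun s : ℝ => Real.exp (-s))
    (f' := fun s => - Real.exp (-s)) MeasurableSet.univ
    (fun x _ => by simpa using ((hasDerivAt_neg x).exp))
    (fun a _ b _ hab => by simpa using hab) f
  have h2 : (fun s : ℝ => Real.exp (-s)) '' univ = Ioi 0 := by
    ext r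
    constructor
    · rintro ⟨s, _, rfl⟩; exact Real.exp_pos _
    · intro hr; exact ⟨-Real.log r, trivial, by simp [Real.exp_log hr]⟩
  rw [h2] at h
  simpa [abs_of_pos (Real.exp_pos _)] using h

theorem volumeIoiPow_eq (m : ℕ) : Measure.volumeIoiPow m =
    ((volume : Measure ℝ).map expNeg).withDensity (fun r => ENNReal.ofReal (r.1 ^ (m + 1))) := by
  ext A hA
  have hm : Measurable expNeg := expNeg_measurableEmbedding.measurable
  rw [Measure.volumeIoiPow, withDensity_apply _ hA, withDensity_apply _ hA,
    ← lintegral_indicator hA, ← lintegral_indicator hA, lintegral_map _ hm]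
  · have : ∀ r : Ioi (0:ℝ), A.indicator (fun r : Ioi (0:ℝ) => ENNReal.ofReal (r.1 ^ m)) r
        = (Subtype.val '' A).indicator (fun r : ℝ => ENNReal.ofReal (r ^ m)) r.1 := by
      intro r
      by_cases hr : r ∈ A
      · rw [indicator_of_mem hr, indicator_of_mem (mem_image_of_mem _ hr)]
      · rw [indicator_of_notMem hr, indicator_of_notMem]
        rintro ⟨r', hr', h⟩
        exact hr (by rwa [← Subtype.ext h])
    simp_rw [this]
    rw [lintegral_subtype_comap measurableSet_Ioi (fun r : ℝ => (Subtype.val '' A).indicator (fun r : ℝ => ENNReal.ofReal (r ^ m)) r), lintegral_expNeg]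
    congr 1
    ext s
    by_cases hr : expNeg s ∈ A
    · have h3 : Real.exp (-s) ∈ Subtype.val '' A := ⟨_, hr, rfl⟩
      rw [indicator_of_mem h3, indicator_of_mem hr, ← ENNReal.ofReal_mul (Real.exp_pos _).le]
      congr 1
      simp only [expNeg]; ring
    · have h3 : Real.exp (-s) ∉ Subtype.val '' A := by
        rintro ⟨r, hr', h⟩
        exact hr (by convert hr'; exact Subtype.ext h.symm)
      rw [indicator_of_notMem h3, indicator_of_notMem hr, mul_zero]
  · apply Measurable.indicator _ hA
    fun_prop

theorem integral_polar {n : ℕ} (hn : 2 ≤ n) (f : EuclideanSpace ℝ (Fin n) → ℝ) :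
    ∫ x, f x = ∫ p : ℝ × EuclideanSpace ℝ (Fin n), Real.exp (-p.1) ^ n * f (Real.exp (-p.1) • p.2)
      ∂((volume : Measure ℝ).prod (sphMeasure n)) := by
  have : Nontrivial (EuclideanSpace ℝ (Fin n)) := by
    have : Nonempty (Fin n) := ⟨⟨0, by omega⟩⟩
    infer_instance
  have hd : Module.finrank ℝ (EuclideanSpace ℝ (Fin n)) - 1 + 1 = n := by simp; omega
  calc ∫ x, f x = ∫ x : ({(0)}ᶜ : Set (EuclideanSpace ℝ (Fin n))), f x.1 ∂((volume : Measure (EuclideanSpace ℝ (Fin n))).comap (↑)) := by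
        rw [integral_subtype_comap (measurableSet_singleton _).compl fun x ↦ f x,
        restrict_compl_singleton]
    _ = ∫ q, f (q.2.1 • q.1.1) ∂(volume : Measure (EuclideanSpace ℝ (Fin n))).toSphere.prod
          (.volumeIoiPow (Module.finrank ℝ (EuclideanSpace ℝ (Fin n)) - 1)) := by
      rw [← (volume : Measure (EuclideanSpace ℝ (Fin n))).measurePreserving_homeomorphUnitSphereProd.integral_comp
        (Homeomorph.measurableEmbedding _)]
      congr 1
      ext x
      have : ‖x.1‖ ≠ 0 := norm_ne_zero_iff.2 x.2
      simp [smul_smul, this]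
    _ = ∫ q, q.2.1 ^ n * f (q.2.1 • q.1.1) ∂(volume : Measure (EuclideanSpace ℝ (Fin n))).toSphere.prod
          ((volume : Measure ℝ).map expNeg) := by
      rw [volumeIoiPow_eq, hd]
      have : SigmaFinite ((volume : Measure ℝ).map expNeg) :=
        expNeg_measurableEmbedding.sigmaFinite_map
      rw [prod_withDensity_right (by fun_prop)]
      rw [integral_withDensity_eq_integral_toReal_smul (by fun_prop) (by simp)]
      congr 1
      ext q
      rw [ENNReal.toReal_ofReal (pow_nonneg q.2.2.le _), smul_eq_mul]
    _ = ∫ q, q.2.1 ^ n * f (q.2.1 • q.1.1) ∂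
          (((volume : Measure (EuclideanSpace ℝ (Fin n))).toSphere.prod (volume : Measure ℝ)).map (Prod.map id expNeg)) := by
      rw [← Measure.map_prod_map _ _ measurable_id expNeg_measurableEmbedding.measurable,
        Measure.map_id]
    _ = ∫ q, (Real.exp (-q.2)) ^ n * f (Real.exp (-q.2) • q.1.1) ∂
          ((volume : Measure (EuclideanSpace ℝ (Fin n))).toSphere.prod (volume : Measure ℝ)) := by
      rw [(MeasurableEmbedding.id.prodMap expNeg_measurableEmbedding).integral_map]
      rfl
    _ = ∫ q, (Real.exp (-q.1)) ^ n * f (Real.exp (-q.1) • q.2.1) ∂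
          ((volume : Measure ℝ).prod (volume : Measure (EuclideanSpace ℝ (Fin n))).toSphere) := by
      rw [← integral_prod_swap]
      rfl
    _ = _ := by
      have : (volume : Measure ℝ).prod (sphMeasure n) =
        ((volume : Measure ℝ).prod (volume : Measure (EuclideanSpace ℝ (Fin n))).toSphere).map
          (Prod.map id Subtype.val) := by
        rw [← Measure.map_prod_map _ _ measurable_id measurable_subtype_coe, Measure.map_id]
        rfl
      rw [this, (MeasurableEmbedding.id.prodMap (MeasurableEmbedding.subtype_coe
        Metric.isClosed_sphere.measurableSet)).integral_map]
      rfl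

theorem sphMeasure_ae (n : ℕ) : ∀ᵐ σ ∂(sphMeasure n), ‖σ‖ = 1 := by
  unfold sphMeasure
  rw [(MeasurableEmbedding.subtype_coe Metric.isClosed_sphere.measurableSet).ae_map_iff]
  filter_upwards with x
  simp

instance sphMeasure_finite (n : ℕ) : IsFiniteMeasure (sphMeasure n) := by
  unfold sphMeasure; infer_instance

theorem integral_cyl {n : ℕ} (hn : 2 ≤ n) {S : Set (EuclideanSpace ℝ (Fin n))}
    (hS : MeasurableSet S) (hΩ : MeasurableSet (coneOf S))
    (G : ℝ × EuclideanSpace ℝ (Fin n) → ℝ) :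
    ∫ x in coneOf S, (‖x‖ ^ n)⁻¹ * G (-Real.log ‖x‖, ‖x‖⁻¹ • x) =
    ∫ p in (Set.univ ×ˢ S), G p ∂((volume : Measure ℝ).prod (sphMeasure n)) := by
  rw [← integral_indicator hΩ, integral_polar hn, ← integral_indicator (MeasurableSet.univ.prod hS)]
  apply integral_congr_ae
  have h := (Measure.quasiMeasurePreserving_snd (μ := (volume : Measure ℝ)) (ν := sphMeasure n)).ae
    (sphMeasure_ae n)
  filter_upwards [h] with p hp
  have h0 : p.2 ≠ 0 := by rintro h; simp [h] at hp
  have he := (Real.exp_pos (-p.1))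
  have hnorm : ‖Real.exp (-p.1) • p.2‖ = Real.exp (-p.1) := by
    rw [norm_smul, hp]; simp
  have hdir : ‖Real.exp (-p.1) • p.2‖⁻¹ • Real.exp (-p.1) • p.2 = p.2 := by
    rw [hnorm, smul_smul, inv_mul_cancel₀ he.ne', one_smul]
  by_cases hm : p.2 ∈ S
  · rw [indicator_of_mem (show _ ∈ coneOf S from ⟨by simp [he.ne', h0], by rwa [hdir]⟩),
      indicator_of_mem (show p ∈ univ ×ˢ S from ⟨trivial, hm⟩), hdir, hnorm]
    simp [he.ne']
  · rw [indicator_of_notMem (fun h => hm (by have := h.2; rwa [hdir] at this)),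
      indicator_of_notMem (fun h : p ∈ univ ×ˢ S => hm h.2), mul_zero]

open MeasureTheory Metric Set Filter
open scoped RealInnerProductSpace Topology

theorem bdd_derivs {X : Type*} [NormedAddCommGroup X] [NormedSpace ℝ X]
    {F : X → ℝ} {A C O : Set X} (hF : ContDiffOn ℝ 2 F A) (hC : IsCompact C) (hCA : C ⊆ A)
    (hO : IsOpen O) (hOA : O ⊆ A) :
    ∃ B : ℝ, 0 ≤ B ∧ ∀ x ∈ C ∩ O, |F x| ≤ B ∧ ‖fderiv ℝ F x‖ ≤ B ∧
      ‖fderiv ℝ (fderiv ℝ F) x‖ ≤ B := by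
  refine hC.induction_on (p := fun t => ∃ B : ℝ, 0 ≤ B ∧ ∀ x ∈ t ∩ O, |F x| ≤ B ∧
    ‖fderiv ℝ F x‖ ≤ B ∧ ‖fderiv ℝ (fderiv ℝ F) x‖ ≤ B) ?_ ?_ ?_ ?_
  · exact ⟨0, le_rfl, fun x hx => hx.1.elim⟩
  · rintro s t hst ⟨B, hB, h⟩
    exact ⟨B, hB, fun x hx => h x ⟨hst hx.1, hx.2⟩⟩
  · rintro s t ⟨B, hB, h⟩ ⟨B', hB', h'⟩
    refine ⟨B + B', by positivity, fun x hx => ?_⟩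
    rcases hx.1 with h1 | h1
    · obtain ⟨a, b, c⟩ := h x ⟨h1, hx.2⟩
      exact ⟨by linarith, by linarith, by linarith⟩
    · obtain ⟨a, b, c⟩ := h' x ⟨h1, hx.2⟩
      exact ⟨by linarith, by linarith, by linarith⟩
  · intro x hx
    have hxA := hCA hx
    obtain ⟨v, hv, p, hp⟩ := (hF x hxA) 2 le_rfl
    rw [insert_eq_of_mem hxA] at hv
    have hxv : x ∈ v := mem_of_mem_nhdsWithin hxA hv
    obtain ⟨U, hU, hUv⟩ := mem_nhdsWithin_iff_exists_mem_nhds_inter.1 hv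
    have hb : ∀ m : ℕ, m ≤ 2 → ∀ᶠ y in 𝓝[v] x, ‖p y m‖ < ‖p x m‖ + 1 := by
      intro m hm
      have := (hp.cont m (by exact_mod_cast hm) x hxv).norm
      exact this.eventually (gt_mem_nhds (by linarith))
    have hb' : ∀ᶠ y in 𝓝[v] x, ‖p y 0‖ < ‖p x 0‖ + 1 ∧ ‖p y 1‖ < ‖p x 1‖ + 1 ∧
        ‖p y 2‖ < ‖p x 2‖ + 1 :=
      (hb 0 (by norm_num)).and ((hb 1 (by norm_num)).and (hb 2 le_rfl))
    obtain ⟨U', hU', hUv'⟩ := mem_nhdsWithin_iff_exists_mem_nhds_inter.1 hb'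
    obtain ⟨V, hVU, hVo, hxV⟩ := _root_.mem_nhds_iff.1 (inter_mem hU hU')
    refine ⟨V ∩ A, inter_mem (mem_nhdsWithin_of_mem_nhds (hVo.mem_nhds hxV) |>
      fun h => nhdsWithin_mono _ hCA h) (mem_of_superset self_mem_nhdsWithin hCA),
      (‖p x 0‖ + 1) + (‖p x 1‖ + 1) + (‖p x 2‖ + 1), by positivity, ?_⟩
    rintro y ⟨⟨hyV, hyA⟩, hyO⟩
    have hsub : V ∩ O ⊆ v := fun z hz => hUv ⟨(hVU hz.1).1, hOA hz.2⟩
    have hopen : IsOpen (V ∩ O) := hVo.inter hO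
    have hp' := hp.mono hsub
    have hy : y ∈ V ∩ O := ⟨hyV, hyO⟩
    have key : ∀ m : ℕ, m ≤ 2 → p y m = iteratedFDeriv ℝ m F y := by
      intro m hm
      rw [hp'.eq_iteratedFDerivWithin_of_uniqueDiffOn (by exact_mod_cast hm)
        hopen.uniqueDiffOn hy, iteratedFDerivWithin_of_isOpen m hopen hy]
    obtain ⟨b0, b1, b2⟩ := hUv' ⟨(hVU hyV).2, hsub hy⟩
    have e0 : |F y| = ‖p y 0‖ := by rw [key 0 (by norm_num), norm_iteratedFDeriv_zero]; rfl
    have e1 : ‖fderiv ℝ F y‖ = ‖p y 1‖ := by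
      rw [key 1 (by norm_num), norm_iteratedFDeriv_one]
    have e2 : ‖fderiv ℝ (fderiv ℝ F) y‖ = ‖p y 2‖ := by
      rw [key 2 le_rfl, ← norm_iteratedFDeriv_one, norm_iteratedFDeriv_fderiv]
    have := norm_nonneg (p x 0)
    have := norm_nonneg (p x 1)
    have := norm_nonneg (p x 2)
    rw [e0, e1, e2]
    exact ⟨by linarith, by linarith, by linarith⟩

theorem fderiv_ae_zero {X : Type*} [NormedAddCommGroup X] [NormedSpace ℝ X]
    [FiniteDimensional ℝ X] [Nontrivial X] [MeasurableSpace X] [BorelSpace X] (μ : Measure X)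
    [μ.IsAddHaarMeasure] {f : X → ℝ} {Ω : Set X} (hΩ : IsOpen Ω)
    (hf : ∀ x ∈ Ω, DifferentiableAt ℝ f x) :
    ∀ᵐ x ∂μ, x ∈ Ω → f x = 0 → fderiv ℝ f x = 0 := by
  obtain ⟨e, he⟩ := exists_ne (0 : X)
  have hc : ContinuousOn f Ω := fun x hx => (hf x hx).continuousAt.continuousWithinAt
  set s := {x ∈ Ω | f x = 0}
  have hs : MeasurableSet s := by
    obtain ⟨U, hU, h⟩ := continuousOn_iff_isClosed.1 hc {0} isClosed_singleton
    have : s = U ∩ Ω := by rw [← h]; ext x; simp [s, and_comm]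
    rw [this]; exact hU.measurableSet.inter hΩ.measurableSet
  have h1 : ApproximatesLinearOn (fun x => f x • e) (0 : X →L[ℝ] X) s 0 := by
    intro x hx y hy
    simp [hx.2, hy.2]
  have h2 := h1.norm_fderiv_sub_le μ hs (fun x => (fderiv ℝ f x).smulRight e) (fun x hx =>
    ((hf x hx.1).hasFDerivAt.smul_const e).hasFDerivWithinAt)
  rw [ae_restrict_iff' hs] at h2
  filter_upwards [h2] with x hx h3 h4
  have := hx ⟨h3, h4⟩
  have h5 : fderiv ℝ f x = 0 ∨ e = 0 := by simpa using this
  exact h5.resolve_right he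

theorem integral_fderiv_zero {X : Type*} [NormedAddCommGroup X] [NormedSpace ℝ X]
    [FiniteDimensional ℝ X] [MeasurableSpace X] [BorelSpace X] (μ : Measure X)
    [μ.IsAddHaarMeasure] {F : X → ℝ} (hF : ContDiff ℝ 1 F) (hc : HasCompactSupport F) (v : X) :
    Integrable (fun x => fderiv ℝ F x v) μ ∧ ∫ x, fderiv ℝ F x v ∂μ = 0 := by
  have h1 : Continuous (fun x => fderiv ℝ F x v) :=
    (hF.continuous_fderiv (by norm_num)).clm_apply continuous_const
  have h2 : HasCompactSupport (fun x => fderiv ℝ F x v) := hc.fderiv_apply ℝ v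
  have hi := h1.integrable_of_hasCompactSupport (μ := μ) h2
  refine ⟨hi, ?_⟩
  have := integral_mul_fderiv_eq_neg_fderiv_mul_of_integrable (𝕜 := ℝ) (μ := μ) (f := F)
    (g := fun _ => (1:ℝ)) (v := v) (by simpa using hi) (by simp)
    (by simpa using hF.continuous.integrable_of_hasCompactSupport hc)
    (fun x _ => hF.differentiable (by norm_num) x) (fun x _ => differentiableAt_const _)
  simpa using this.symm

/-- derivative of the truncation -/
noncomputable def chi' (k : ℕ) (t : ℝ) : ℝ := Real.smoothTransition (((k:ℝ) + 1) ^ 2 * t ^ 2 - 1)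
/-- the truncation -/
noncomputable def chi (k : ℕ) (t : ℝ) : ℝ := ∫ τ in (0:ℝ)..t, chi' k τ

theorem chi'_cont (k : ℕ) : Continuous (chi' k) := by
  unfold chi'
  exact Real.smoothTransition.continuous.comp (by fun_prop)
theorem chi'_bd (k : ℕ) (t : ℝ) : |chi' k t| ≤ 1 := by
  unfold chi'
  rw [abs_of_nonneg (Real.smoothTransition.nonneg _)]; exact Real.smoothTransition.le_one _
theorem chi'_zero (k : ℕ) {t : ℝ} (h : |t| ≤ 1 / ((k:ℝ) + 1)) : chi' k t = 0 := by
  apply Real.smoothTransition.zero_of_nonpos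
  have h1 : t ^ 2 ≤ (1 / ((k:ℝ) + 1)) ^ 2 := by rw [← sq_abs]; gcongr
  have h2 : ((k:ℝ)+1)^2 * (1 / ((k:ℝ) + 1)) ^ 2 = 1 := by field_simp
  nlinarith [mul_le_mul_of_nonneg_left h1 (sq_nonneg ((k:ℝ)+1))]
theorem chi'_tendsto {t : ℝ} (ht : t ≠ 0) : Tendsto (fun k => chi' k t) atTop (𝓝 1) := by
  apply tendsto_const_nhds.congr'
  obtain ⟨N, hN⟩ := exists_nat_gt (2 / t ^ 2)
  filter_upwards [eventually_ge_atTop N] with k hk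
  symm
  apply Real.smoothTransition.one_of_one_le
  have h0 : 0 < t ^ 2 := by positivity
  have h1 : 2 / t ^ 2 < k := hN.trans_le (by exact_mod_cast hk)
  rw [div_lt_iff₀ h0] at h1
  nlinarith [mul_nonneg (Nat.cast_nonneg (α := ℝ) k) h0.le, mul_nonneg (mul_nonneg (Nat.cast_nonneg (α := ℝ) k) (Nat.cast_nonneg (α := ℝ) k)) h0.le]
theorem chi_hasDerivAt (k : ℕ) (t : ℝ) : HasDerivAt (chi k) (chi' k t) t :=
  intervalIntegral.integral_hasDerivAt_right ((chi'_cont k).intervalIntegrable _ _)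
    ((chi'_cont k).stronglyMeasurableAtFilter _ _) (chi'_cont k).continuousAt
theorem chi_contDiff (k : ℕ) : ContDiff ℝ 1 (chi k) := by
  rw [contDiff_one_iff_deriv]
  refine ⟨fun t => (chi_hasDerivAt k t).differentiableAt, ?_⟩
  have : deriv (chi k) = chi' k := funext fun t => (chi_hasDerivAt k t).deriv
  rw [this]; exact chi'_cont k
theorem chi_zero (k : ℕ) {t : ℝ} (h : |t| ≤ 1 / ((k:ℝ) + 1)) : chi k t = 0 := by
  unfold chi
  rw [intervalIntegral.integral_congr (g := fun _ => (0:ℝ))]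
  · simp
  · intro τ hτ
    apply chi'_zero
    refine le_trans ?_ h
    have := Set.abs_sub_left_of_mem_uIcc hτ
    simpa using this
theorem chi_bd (k : ℕ) (t : ℝ) : |chi k t| ≤ |t| := by
  have := intervalIntegral.norm_integral_le_of_norm_le_const (a := 0) (b := t) (f := chi' k) (C := 1)
    (fun x _ => chi'_bd k x)
  simpa [chi] using this
theorem chi_tendsto (t : ℝ) : Tendsto (fun k => chi k t) atTop (𝓝 t) := by
  have := intervalIntegral.tendsto_integral_filter_of_dominated_convergence (μ := volume)
    (F := fun k => chi' k) (l := atTop) (f := fun _ => 1) (a := 0) (b := t) (fun _ => (1:ℝ))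
    (Eventually.of_forall fun k => (chi'_cont k).aestronglyMeasurable)
    (Eventually.of_forall fun k => Eventually.of_forall fun x _ => chi'_bd k x)
    (by simp) (by
      have : ∀ᵐ x : ℝ, x ≠ 0 := by simp [ae_iff]
      filter_upwards [this] with x hx _
      exact chi'_tendsto hx)
  simpa [chi] using this

open MeasureTheory Metric Set Filter
open scoped RealInnerProductSpace Topology

theorem lap_eq {n : ℕ} (g : EuclideanSpace ℝ (Fin n) → ℝ) (x : EuclideanSpace ℝ (Fin n)) :
    lap g x = ∑ i, fderiv ℝ (fderiv ℝ g) x (EuclideanSpace.single i 1)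
      (EuclideanSpace.single i 1) := by
  unfold lap
  simp [iteratedFDeriv_two_apply]

theorem sum_single {n : ℕ} (x : EuclideanSpace ℝ (Fin n)) :
    ∑ i, x i • EuclideanSpace.single i (1:ℝ) = x := by
  have := (EuclideanSpace.basisFun (Fin n) ℝ).sum_repr x
  simpa using this

theorem clm_sum_single {n : ℕ} (T : EuclideanSpace ℝ (Fin n) →L[ℝ] ℝ)
    (x : EuclideanSpace ℝ (Fin n)) :
    ∑ i, x i * T (EuclideanSpace.single i (1:ℝ)) = T x := by
  conv_rhs => rw [← sum_single x, map_sum]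
  simp

/-- radial bump -/
noncomputable def thb : ContDiffBump (2:ℝ) := ⟨1/2, 1, by norm_num, by norm_num⟩

theorem thb_zero {q : ℝ} (h : q ≤ 1 ∨ 4 ≤ q) : thb q = 0 := by
  apply thb.zero_of_le_dist
  rw [Real.dist_eq]
  simp only [thb]
  rcases h with h | h
  · rw [abs_of_nonpos (by linarith)]; linarith
  · rw [abs_of_nonneg (by linarith)]; linarith

theorem green_aux {n : ℕ} (hn : 2 ≤ n) {Ω : Set (EuclideanSpace ℝ (Fin n))} (hΩ : IsOpen Ω)
    {f g : EuclideanSpace ℝ (Fin n) → ℝ}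
    (hf : ∀ x ∈ Ω, ContDiffAt ℝ 2 f x) (hg : ∀ x ∈ Ω, ContDiffAt ℝ 2 g x)
    (hfc : ContinuousOn f (closure Ω \ {0})) (hf0 : ∀ x ∈ closure Ω \ {0}, x ∉ Ω → f x = 0)
    (hrad : ∀ x ∈ Ω, fderiv ℝ g x x = 0) {B : ℝ}
    (hB : ∀ x ∈ Ω, 1 ≤ ‖x‖ → ‖x‖ ≤ 2 → |f x| ≤ B ∧ ‖fderiv ℝ f x‖ ≤ B ∧ ‖fderiv ℝ g x‖ ≤ B ∧
      ‖fderiv ℝ (fderiv ℝ g) x‖ ≤ B) :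
    ∫ x in Ω, thb (‖x‖ ^ 2) * (f x * lap g x + ∑ i, fderiv ℝ f x (EuclideanSpace.single i 1) *
      fderiv ℝ g x (EuclideanSpace.single i 1)) = 0 := by
  have : Nontrivial (EuclideanSpace ℝ (Fin n)) := by
    have : Nonempty (Fin n) := ⟨⟨0, by omega⟩⟩
    infer_instance
  classical
  let e : Fin n → EuclideanSpace ℝ (Fin n) := fun i => EuclideanSpace.single i 1
  have hthc : ContDiff ℝ 1 (fun x : EuclideanSpace ℝ (Fin n) => thb (‖x‖ ^ 2)) :=
    thb.contDiff.comp (contDiff_norm_sq ℝ)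
  have hsupp : HasCompactSupport (fun x : EuclideanSpace ℝ (Fin n) => thb (‖x‖ ^ 2)) := by
    apply HasCompactSupport.intro (isCompact_closedBall (0 : EuclideanSpace ℝ (Fin n)) 2)
    intro x hx
    apply thb_zero
    right
    simp only [mem_closedBall, dist_zero_right, not_le] at hx
    nlinarith
  let F : ℕ → Fin n → EuclideanSpace ℝ (Fin n) → ℝ := fun k i => Ω.indicator
    (fun x => thb (‖x‖ ^ 2) * (chi k (f x) * fderiv ℝ g x (e i)))
  have hFout : ∀ k i x, x ∉ Ω → F k i =ᶠ[𝓝 x] 0 := by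
    intro k i x hx
    by_cases h0 : x = 0
    · have : ∀ᶠ y in 𝓝 x, ‖y‖ ^ 2 < 1 := by
        have : Continuous fun y : EuclideanSpace ℝ (Fin n) => ‖y‖ ^ 2 := by fun_prop
        exact this.continuousAt.eventually (gt_mem_nhds (by simp [h0]))
      filter_upwards [this] with y hy
      simp [F, indicator, thb_zero (Or.inl hy.le)]
    by_cases hc : x ∈ closure Ω
    · have hx' : x ∈ closure Ω \ {0} := ⟨hc, h0⟩
      have h1 := hfc x hx'
      have h2 : ∀ᶠ y in 𝓝[closure Ω \ {0}] x, |f y| < 1 / ((k:ℝ) + 1) := by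
        apply h1.abs.eventually (gt_mem_nhds _)
        simp only [hf0 x hx' hx, abs_zero]; positivity
      rw [eventually_nhdsWithin_iff] at h2
      filter_upwards [h2, isOpen_ne.mem_nhds h0] with y hy hy0
      by_cases hyΩ : y ∈ Ω
      · simp [F, chi_zero k (hy ⟨subset_closure hyΩ, hy0⟩).le]
      · simp [F, hyΩ]
    · filter_upwards [isClosed_closure.isOpen_compl.mem_nhds hc] with y hy
      have : y ∉ Ω := fun h => hy (subset_closure h)
      simp [F, this]
  have hgD : ∀ x ∈ Ω, ContDiffAt ℝ 1 (fderiv ℝ g) x := fun x hx =>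
    (hg x hx).fderiv_right (by norm_num)
  have hFin : ∀ k i x, x ∈ Ω → F k i =ᶠ[𝓝 x]
      (fun x => thb (‖x‖ ^ 2) * (chi k (f x) * fderiv ℝ g x (e i))) := by
    intro k i x hx
    filter_upwards [hΩ.mem_nhds hx] with y hy
    simp [F, hy]
  have hFC : ∀ k i, ContDiff ℝ 1 (F k i) := by
    intro k i
    rw [contDiff_iff_contDiffAt]
    intro x
    by_cases hx : x ∈ Ω
    · apply ContDiffAt.congr_of_eventuallyEq _ (hFin k i x hx)
      exact hthc.contDiffAt.mul (((chi_contDiff k).contDiffAt.comp x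
        ((hf x hx).of_le (by norm_num))).mul ((hgD x hx).clm_apply contDiffAt_const))
    · exact (contDiffAt_const (c := (0:ℝ))).congr_of_eventuallyEq (hFout k i x hx)
  have hFS : ∀ k i, HasCompactSupport (F k i) := by
    intro k i
    apply hsupp.mono
    intro x hx hx'
    apply hx
    have h' : thb (‖x‖ ^ 2) = 0 := hx'
    simp [F, indicator, h']
  let I : ℕ → EuclideanSpace ℝ (Fin n) → ℝ := fun k x => thb (‖x‖ ^ 2) * (chi k (f x) * lap g x +
      chi' k (f x) * ∑ i, fderiv ℝ f x (EuclideanSpace.single i 1) *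
      fderiv ℝ g x (EuclideanSpace.single i 1))
  have hder : ∀ k, ∀ x ∈ Ω, ∑ i, fderiv ℝ (F k i) x (e i) = I k x := by
    intro k x hx
    have hfd := ((hf x hx).differentiableAt (by norm_num)).hasFDerivAt
    have h1 := (chi_hasDerivAt k (f x)).comp_hasFDerivAt x hfd
    have hthd : HasFDerivAt (fun x : EuclideanSpace ℝ (Fin n) => thb (‖x‖ ^ 2))
      (deriv thb (‖x‖ ^ 2) • (2 • (innerSL ℝ x))) x := by
      have h2 : HasDerivAt thb (deriv thb (‖x‖ ^ 2)) (‖x‖ ^ 2) :=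
        ((thb.contDiff (n := 1)).differentiable (by norm_num) _).hasDerivAt
      exact HasDerivAt.comp_hasFDerivAt (h₂ := thb) (f := fun x : EuclideanSpace ℝ (Fin n) => ‖x‖ ^ 2) x h2 (hasStrictFDerivAt_norm_sq x).hasFDerivAt
    have h3 : ∀ i, fderiv ℝ (F k i) x (e i) = thb (‖x‖ ^ 2) * (chi k (f x) *
        fderiv ℝ (fderiv ℝ g) x (e i) (e i) + chi' k (f x) * (fderiv ℝ f x (e i) *
        fderiv ℝ g x (e i))) + (2 * deriv thb (‖x‖ ^ 2) * chi k (f x)) *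
          (x i * fderiv ℝ g x (e i)) := by
      intro i
      rw [(hFin k i x hx).fderiv_eq]
      have h4 : HasFDerivAt (fun y => fderiv ℝ g y (e i)) _ x :=
        (((hgD x hx).differentiableAt (by norm_num)).hasFDerivAt).clm_apply
        (hasFDerivAt_const (e i) x)
      have h5 := hthd.mul (h1.mul h4)
      erw [h5.fderiv]
      simp [e, EuclideanSpace.inner_single_right]
      ring
    simp_rw [h3]
    rw [Finset.sum_add_distrib, ← Finset.mul_sum, ← Finset.mul_sum, clm_sum_single, hrad x hx,
      Finset.sum_add_distrib, ← Finset.mul_sum, ← Finset.mul_sum]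
    simp only [I, lap_eq, e]
    ring
  have hFi := fun k i => integral_fderiv_zero (volume : Measure (EuclideanSpace ℝ (Fin n)))
    (hFC k i) (hFS k i) (e i)
  have hder0 : ∀ k, ∀ x ∉ Ω, ∑ i, fderiv ℝ (F k i) x (e i) = 0 := by
    intro k x hx
    apply Finset.sum_eq_zero
    intro i _
    rw [(hFout k i x hx).fderiv_eq]
    simp
  have hI0 : ∀ k, ∫ x in Ω, I k x = 0 := by
    intro k
    rw [setIntegral_congr_fun hΩ.measurableSet (fun x hx => (hder k x hx).symm),
      setIntegral_eq_integral_of_forall_compl_eq_zero (fun x hx => hder0 k x hx),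
      integral_finsetSum _ (fun i _ => (hFi k i).1)]
    exact Finset.sum_eq_zero fun i _ => (hFi k i).2
  have hIm : ∀ k, AEStronglyMeasurable (I k) (volume.restrict Ω) := by
    intro k
    have h1 : Integrable (fun x => ∑ i, fderiv ℝ (F k i) x (e i)) volume :=
      integrable_finsetSum _ (fun i _ => (hFi k i).1)
    apply h1.aestronglyMeasurable.restrict.congr
    filter_upwards [ae_restrict_mem hΩ.measurableSet] with x hx
    exact hder k x hx
  have hlim := tendsto_integral_of_dominated_convergence (μ := volume.restrict Ω) (F := I)
    (f := fun x => thb (‖x‖ ^ 2) * (f x * lap g x + ∑ i, fderiv ℝ f x (EuclideanSpace.single i 1) *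
      fderiv ℝ g x (EuclideanSpace.single i 1))) (fun x => thb (‖x‖^2) * (2 * n * B ^ 2)) hIm
    ((hthc.continuous.integrable_of_hasCompactSupport hsupp).mul_const _).restrict ?_ ?_
  · simp_rw [hI0] at hlim
    exact tendsto_nhds_unique hlim tendsto_const_nhds
  · intro k
    filter_upwards [ae_restrict_mem hΩ.measurableSet] with x hx
    by_cases hth : thb (‖x‖ ^ 2) = 0
    · simp [I, hth]
    have hq : ¬ (‖x‖ ^ 2 ≤ 1 ∨ 4 ≤ ‖x‖ ^ 2) := fun h => hth (thb_zero h)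
    push Not at hq
    have hx0 := norm_nonneg x
    obtain ⟨b1, b2, b3, b4⟩ := hB x hx (by nlinarith) (by nlinarith)
    have hB0 : 0 ≤ B := (abs_nonneg _).trans b1
    simp only [I, norm_mul, Real.norm_eq_abs]
    rw [abs_of_nonneg thb.nonneg]
    apply mul_le_mul_of_nonneg_left _ thb.nonneg
    have hlap : |lap g x| ≤ n * B := by
      rw [lap_eq]
      refine (Finset.abs_sum_le_sum_abs _ _).trans ?_
      refine (Finset.sum_le_card_nsmul _ _ B ?_).trans (by simp)
      intro i _
      have := (fderiv ℝ (fderiv ℝ g) x).le_opNorm₂ (e i) (e i)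
      simp only [e, EuclideanSpace.norm_single, norm_one, mul_one] at this
      exact this.trans b4
    have hsum : |∑ i, fderiv ℝ f x (EuclideanSpace.single i 1) *
      fderiv ℝ g x (EuclideanSpace.single i 1)| ≤ n * (B * B) := by
      refine (Finset.abs_sum_le_sum_abs _ _).trans ?_
      refine (Finset.sum_le_card_nsmul _ _ (B * B) ?_).trans (by simp)
      intro i _
      rw [abs_mul]
      have h1 := (fderiv ℝ f x).le_opNorm (e i)
      have h2 := (fderiv ℝ g x).le_opNorm (e i)
      simp only [e, EuclideanSpace.norm_single, norm_one, mul_one] at h1 h2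
      exact mul_le_mul (h1.trans b2) (h2.trans b3) (abs_nonneg _) hB0
    refine (abs_add_le _ _).trans ?_
    rw [abs_mul, abs_mul]
    have h1 := mul_le_mul ((chi_bd k (f x)).trans b1) hlap (abs_nonneg _) hB0
    have h2 := mul_le_mul (chi'_bd k (f x)) hsum (abs_nonneg _) zero_le_one
    nlinarith
  · have h0 := fderiv_ae_zero (volume : Measure (EuclideanSpace ℝ (Fin n))) hΩ
      (fun x hx => (hf x hx).differentiableAt (by norm_num))
    filter_upwards [ae_restrict_mem hΩ.measurableSet, ae_restrict_of_ae h0] with x hx hx0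
    apply Tendsto.const_mul
    apply Tendsto.add ((chi_tendsto _).mul_const _)
    by_cases hfx : f x = 0
    · simp [hx0 hx hfx]
    · simpa using (chi'_tendsto hfx).mul_const (∑ i, fderiv ℝ f x (EuclideanSpace.single i 1) *
        fderiv ℝ g x (EuclideanSpace.single i 1))

open MeasureTheory Metric Set Filter
open scoped RealInnerProductSpace Topology

theorem coneOf_smul {n : ℕ} {S : Set (EuclideanSpace ℝ (Fin n))} {x : EuclideanSpace ℝ (Fin n)}
    {r : ℝ} (hr : 0 < r) : r • x ∈ coneOf S ↔ x ∈ coneOf S := by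
  have : ‖r • x‖⁻¹ • r • x = ‖x‖⁻¹ • x := by
    rw [norm_smul, smul_smul, Real.norm_of_nonneg hr.le, mul_inv]
    congr 1
    field_simp
  simp [coneOf, this, hr.ne']

theorem closure_coneOf_smul {n : ℕ} {S : Set (EuclideanSpace ℝ (Fin n))}
    {x : EuclideanSpace ℝ (Fin n)}
    {r : ℝ} (hr : 0 < r) (hx : x ∈ closure (coneOf S)) : r • x ∈ closure (coneOf S) := by
  have : MapsTo (fun y : EuclideanSpace ℝ (Fin n) => r • y) (coneOf S) (coneOf S) :=
    fun y hy => (coneOf_smul hr).2 hy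
  exact this.closure (continuous_const_smul r) hx

theorem IsSphDomain.measurable {n : ℕ} {S : Set (EuclideanSpace ℝ (Fin n))} (hS : IsSphDomain S) :
    MeasurableSet S := by
  have h := (MeasurableEmbedding.subtype_coe (Metric.isClosed_sphere
    (x := (0 : EuclideanSpace ℝ (Fin n))) (ε := 1)).measurableSet).measurableSet_image.2
    hS.2.1.measurableSet
  rwa [Subtype.image_preimage_coe, inter_eq_right.2 hS.1] at h

theorem IsSphDomain.isOpen_cone {n : ℕ} {S : Set (EuclideanSpace ℝ (Fin n))}
    (hS : IsSphDomain S) : IsOpen (coneOf S) := by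
  obtain ⟨U, hU, h⟩ := isOpen_induced_iff.1 hS.2.1
  have hc : ContinuousOn (fun x : EuclideanSpace ℝ (Fin n) => ‖x‖⁻¹ • x) {0}ᶜ := by
    have h1 : ContinuousOn (fun x : EuclideanSpace ℝ (Fin n) => ‖x‖⁻¹) {0}ᶜ :=
      continuous_norm.continuousOn.inv₀ (fun x hx => norm_ne_zero_iff.2 hx)
    exact h1.smul (continuousOn_id (s := {0}ᶜ))
  have h2 := hc.isOpen_inter_preimage isOpen_compl_singleton hU
  convert h2 using 1
  ext x
  simp only [coneOf, mem_ofPred_eq, mem_inter_iff, mem_compl_iff, mem_singleton_iff, mem_preimage]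
  apply and_congr_right
  intro hx
  have hs : ‖x‖⁻¹ • x ∈ sphere (0 : EuclideanSpace ℝ (Fin n)) 1 := by
    simp [norm_smul, hx]
  have := congrArg (fun A => (⟨_, hs⟩ : sphere (0 : EuclideanSpace ℝ (Fin n)) 1) ∈ A) h
  simp only [mem_preimage, eq_iff_iff] at this
  exact this.symm

theorem S_sub_cone {n : ℕ} {S : Set (EuclideanSpace ℝ (Fin n))} (hS : IsSphDomain S) :
    S ⊆ coneOf S := by
  intro x hx
  have : ‖x‖ = 1 := by simpa using hS.1 hx
  refine ⟨fun h => by simp [h] at this, by simpa [this] using hx⟩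

section homog
variable {n : ℕ} {f : EuclideanSpace ℝ (Fin n) → ℝ}

theorem fderiv_homog (hf : ∀ (r : ℝ), 0 < r → ∀ x, f (r • x) = f x) {r : ℝ} (hr : 0 < r)
    (x : EuclideanSpace ℝ (Fin n)) : r • fderiv ℝ f (r • x) = fderiv ℝ f x := by
  rw [← fderiv_comp_smul]
  congr 1
  ext y; exact hf r hr y

theorem fderiv2_homog (hf : ∀ (r : ℝ), 0 < r → ∀ x, f (r • x) = f x) {r : ℝ} (hr : 0 < r)
    (x : EuclideanSpace ℝ (Fin n)) :
    (r ^ 2) • fderiv ℝ (fderiv ℝ f) (r • x) = fderiv ℝ (fderiv ℝ f) x := by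
  have h1 : (fun y => r • fderiv ℝ f (r • y)) = fderiv ℝ f := funext fun y => fderiv_homog hf hr y
  conv_rhs => rw [← h1]
  have h2 := congrFun (fderiv_const_smul_field (𝕜 := ℝ) (f := fun y => fderiv ℝ f (r • y)) r) x
  change _ = fderiv ℝ (r • fun y => fderiv ℝ f (r • y)) x
  rw [h2, Pi.smul_apply, fderiv_comp_smul, smul_smul, sq]

theorem lap_homog (hf : ∀ (r : ℝ), 0 < r → ∀ x, f (r • x) = f x) {r : ℝ} (hr : 0 < r)
    (x : EuclideanSpace ℝ (Fin n)) : (r ^ 2) * lap f (r • x) = lap f x := by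
  simp only [lap_eq, Finset.mul_sum, ← fderiv2_homog hf hr x]
  simp

theorem fderiv_radial (hf : ∀ (r : ℝ), 0 < r → ∀ x, f (r • x) = f x)
    {x : EuclideanSpace ℝ (Fin n)} (hd : DifferentiableAt ℝ f x) : fderiv ℝ f x x = 0 := by
  have h1 : HasDerivAt (fun t : ℝ => t • x) x 1 := by
    simpa using (hasDerivAt_id (1:ℝ)).smul_const x
  have hd' : HasFDerivAt f (fderiv ℝ f x) ((1:ℝ) • x) := by rw [one_smul]; exact hd.hasFDerivAt
  have h2 := hd'.comp_hasDerivAt (1:ℝ) h1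
  have h3 : HasDerivAt (f ∘ fun t : ℝ => t • x) 0 1 := by
    apply (hasDerivAt_const (1:ℝ) (f x)).congr_of_eventuallyEq
    filter_upwards [lt_mem_nhds (zero_lt_one (α := ℝ))] with t ht
    exact hf t ht x
  exact h2.unique h3
end homog

theorem green_sphere {n : ℕ} (hn : 2 ≤ n) {S : Set (EuclideanSpace ℝ (Fin n))}
    (hS : IsSphDomain S)
    {f g : EuclideanSpace ℝ (Fin n) → ℝ}
    (hf : ∀ x ∈ coneOf S, ContDiffAt ℝ 2 f x) (hg : ∀ x ∈ coneOf S, ContDiffAt ℝ 2 g x)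
    (hfc : ContinuousOn f (closure (coneOf S) \ {0}))
    (hf0 : ∀ x ∈ closure (coneOf S) \ {0}, x ∉ coneOf S → f x = 0)
    (hfh : ∀ (r : ℝ), 0 < r → ∀ x, f (r • x) = f x)
    (hgh : ∀ (r : ℝ), 0 < r → ∀ x, g (r • x) = g x) {B : ℝ}
    (hB : ∀ x ∈ coneOf S, 1 ≤ ‖x‖ → ‖x‖ ≤ 2 → |f x| ≤ B ∧ ‖fderiv ℝ f x‖ ≤ B ∧ ‖fderiv ℝ g x‖ ≤ B ∧
      ‖fderiv ℝ (fderiv ℝ g) x‖ ≤ B) :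
    ∫ x in S, (f x * lap g x + ∑ i, fderiv ℝ f x (EuclideanSpace.single i 1) *
      fderiv ℝ g x (EuclideanSpace.single i 1)) ∂(sphMeasure n) = 0 := by
  have h0 := green_aux hn hS.isOpen_cone hf hg hfc hf0
    (fun x hx => fderiv_radial hgh ((hg x hx).differentiableAt (by norm_num))) hB
  let H : EuclideanSpace ℝ (Fin n) → ℝ := fun x => f x * lap g x + ∑ i,
      fderiv ℝ f x (EuclideanSpace.single i 1) * fderiv ℝ g x (EuclideanSpace.single i 1)
  have hH : ∀ (r : ℝ), 0 < r → ∀ x, r ^ 2 * H (r • x) = H x := by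
    intro r hr x
    simp only [H, ← lap_homog hgh hr x, ← fderiv_homog hgh hr x, ← fderiv_homog hfh hr x, hfh r hr x]
    rw [mul_add, Finset.mul_sum]
    congr 1
    · ring
    · apply Finset.sum_congr rfl
      intro i _
      simp; ring
  let b : ℝ → ℝ := fun s => thb (Real.exp (-s) ^ 2) * Real.exp (-s) ^ n * (Real.exp (-s) ^ 2)⁻¹
  have h1 := integral_cyl hn hS.measurable hS.isOpen_cone.measurableSet (fun p => b p.1 * H p.2)
  have h2 : ∫ x in coneOf S, (‖x‖ ^ n)⁻¹ * (b (-Real.log ‖x‖) * H (‖x‖⁻¹ • x)) = 0 := by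
    rw [← h0]
    apply setIntegral_congr_fun hS.isOpen_cone.measurableSet
    intro x hx
    have hx0 : 0 < ‖x‖ := norm_pos_iff.2 hx.1
    have := hH ‖x‖⁻¹ (inv_pos.2 hx0) x
    change _ = thb (‖x‖ ^ 2) * H x
    rw [← this]
    simp only [b, neg_neg, Real.exp_log hx0]
    field_simp
  simp only at h1
  rw [h2, ← Measure.prod_restrict, Measure.restrict_univ, integral_prod_mul] at h1
  have hb : 0 < ∫ s, b s := by
    apply Continuous.integral_pos_of_hasCompactSupport_nonneg_nonzero (x := -(Real.log 2) / 2)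
    · have : Continuous (thb : ℝ → ℝ) := thb.continuous
      have h : ∀ s : ℝ, Real.exp (-s) ^ 2 ≠ 0 := fun s => by positivity
      fun_prop (disch := exact h _)
    · apply HasCompactSupport.intro (isCompact_Icc (a := -1) (b := 1))
      intro s hs
      have : thb (Real.exp (-s) ^ 2) = 0 := by
        apply thb_zero
        rw [mem_Icc, not_and_or] at hs
        rcases hs with hs | hs
        · right
          have := Real.add_one_le_exp (-s)
          nlinarith
        · left
          have : Real.exp (-s) ≤ 1 := by rw [Real.exp_le_one_iff]; linarith
          nlinarith [Real.exp_pos (-s)]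
      simp [b, this]
    · intro s
      have := thb.nonneg (x := Real.exp (-s) ^ 2)
      simp only [b, Pi.zero_apply]; positivity
    · have : Real.exp (-(-(Real.log 2) / 2)) ^ 2 = 2 := by
        rw [← Real.exp_nat_mul]
        rw [show ((2:ℕ):ℝ) * (-(-(Real.log 2) / 2)) = Real.log 2 by push_cast; ring]
        exact Real.exp_log (by norm_num)
      simp only [b, this]
      have : thb 2 = 1 := thb.one_of_mem_closedBall (by simp [thb])
      rw [this]
      positivity
  exact (mul_eq_zero.1 h1.symm).resolve_left hb.ne'

open MeasureTheory Metric Set Filter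
open scoped RealInnerProductSpace Topology

/-- Working hypotheses on the zero-homogeneous extension of the cylinder function. -/
structure CylOK {n : ℕ} (S : Set (EuclideanSpace ℝ (Fin n)))
    (W : ℝ × EuclideanSpace ℝ (Fin n) → ℝ) (M B : ℝ) : Prop where
  smooth : ∀ p, p.2 ∈ coneOf S → ContDiffAt ℝ 2 W p
  cont : ∀ s, ContinuousOn (fun x => W (s, x)) (closure (coneOf S) \ {0})
  bdry : ∀ s, ∀ x ∈ closure (coneOf S) \ {0}, x ∉ coneOf S → W (s, x) = 0
  homog : ∀ s (r : ℝ), 0 < r → ∀ x, W (s, r • x) = W (s, x)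
  supp : ∀ p, p.2 ∈ coneOf S → M ≤ |p.1| →
    W p = 0 ∧ fderiv ℝ W p = 0 ∧ fderiv ℝ (fderiv ℝ W) p = 0
  bound : ∀ p, p.2 ∈ coneOf S → 1 ≤ ‖p.2‖ → ‖p.2‖ ≤ 2 →
    |W p| ≤ B ∧ ‖fderiv ℝ W p‖ ≤ B ∧ ‖fderiv ℝ (fderiv ℝ W) p‖ ≤ B
  Bnonneg : 0 ≤ B
  Mnonneg : 0 ≤ M

theorem ext_formula {n : ℕ} {κ : ℝ} {u : EuclideanSpace ℝ (Fin n) → ℝ}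
    {w : ℝ × EuclideanSpace ℝ (Fin n) → ℝ}
    (hw : ∀ x : EuclideanSpace ℝ (Fin n), x ≠ 0 →
      u x = ‖x‖ ^ κ * w (-Real.log ‖x‖, ‖x‖⁻¹ • x)) (s : ℝ) {x : EuclideanSpace ℝ (Fin n)}
    (hx : x ≠ 0) :
    w (s, ‖x‖⁻¹ • x) = Real.exp (κ * s) * u (Real.exp (-s) • ‖x‖⁻¹ • x) := by
  have hx0 : 0 < ‖x‖ := norm_pos_iff.2 hx
  have hy : ‖Real.exp (-s) • ‖x‖⁻¹ • x‖ = Real.exp (-s) := by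
    rw [norm_smul, norm_smul, norm_inv, norm_norm, inv_mul_cancel₀ hx0.ne', mul_one]
    exact Real.norm_of_nonneg (Real.exp_pos _).le
  rw [hw _ (by rw [← norm_pos_iff, hy]; exact Real.exp_pos _), hy, Real.log_exp, neg_neg,
    smul_smul (Real.exp (-s))⁻¹, inv_mul_cancel₀ (Real.exp_pos _).ne', one_smul, ← mul_assoc,
    ← Real.exp_mul, ← Real.exp_add, show κ * s + -s * κ = 0 by ring, Real.exp_zero, one_mul]

theorem ext_ok {n : ℕ} {κ : ℝ} {S : Set (EuclideanSpace ℝ (Fin n))} (hS : IsSphDomain S)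
    {u : EuclideanSpace ℝ (Fin n) → ℝ} (hu : NavierAdm (coneOf S) u)
    {w : ℝ × EuclideanSpace ℝ (Fin n) → ℝ}
    (hw : ∀ x : EuclideanSpace ℝ (Fin n), x ≠ 0 →
      u x = ‖x‖ ^ κ * w (-Real.log ‖x‖, ‖x‖⁻¹ • x)) :
    ∃ M B, CylOK S (fun p => w (p.1, ‖p.2‖⁻¹ • p.2)) M B := by
  obtain ⟨hu2, hu0, ⟨ε, hε, hue⟩, R, huR⟩ := hu
  set W : ℝ × EuclideanSpace ℝ (Fin n) → ℝ := fun p => w (p.1, ‖p.2‖⁻¹ • p.2) with hW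
  set Ω := coneOf S with hΩ
  have hΩo : IsOpen Ω := hS.isOpen_cone
  have hΩ0 : ∀ x ∈ Ω, x ≠ 0 := fun x hx => hx.1
  have hform : ∀ p : ℝ × EuclideanSpace ℝ (Fin n), p.2 ≠ 0 →
      W p = Real.exp (κ * p.1) * u (Real.exp (-p.1) • ‖p.2‖⁻¹ • p.2) :=
    fun p hp => ext_formula hw p.1 hp
  set A : Set (ℝ × EuclideanSpace ℝ (Fin n)) := univ ×ˢ (closure Ω \ {0}) with hA
  set O : Set (ℝ × EuclideanSpace ℝ (Fin n)) := univ ×ˢ Ω with hO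
  have hOo : IsOpen O := isOpen_univ.prod hΩo
  have hOA : O ⊆ A := prod_mono_right fun x hx => ⟨subset_closure hx, hΩ0 x hx⟩
  have hC : ContDiffOn ℝ 2 W A := by
    have hn' : ContDiffOn ℝ 2 (fun p : ℝ × EuclideanSpace ℝ (Fin n) => ‖p.2‖⁻¹) A := by
      intro p hp
      have h1 : ContDiffAt ℝ 2 (fun p : ℝ × EuclideanSpace ℝ (Fin n) => ‖p.2‖) p :=
        contDiffAt_snd.norm ℝ hp.2.2
      exact (h1.inv (norm_ne_zero_iff.2 hp.2.2)).contDiffWithinAt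
    have h1 : ContDiffOn ℝ 2 (fun p : ℝ × EuclideanSpace ℝ (Fin n) =>
        Real.exp (-p.1) • ‖p.2‖⁻¹ • p.2) A := by
      have ha : ContDiffOn ℝ 2 (fun p : ℝ × EuclideanSpace ℝ (Fin n) => Real.exp (-p.1)) A :=
        (Real.contDiff_exp.comp contDiff_fst.neg).contDiffOn
      exact ha.smul (hn'.smul contDiff_snd.contDiffOn)
    have h2 : ContDiffOn ℝ 2 (fun p : ℝ × EuclideanSpace ℝ (Fin n) =>
        u (Real.exp (-p.1) • ‖p.2‖⁻¹ • p.2)) A := by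
      apply hu2.comp h1
      intro p hp
      exact closure_coneOf_smul (Real.exp_pos _) (closure_coneOf_smul
        (inv_pos.2 (norm_pos_iff.2 hp.2.2)) hp.2.1)
    have h3 : ContDiffOn ℝ 2 (fun p : ℝ × EuclideanSpace ℝ (Fin n) => Real.exp (κ * p.1)) A :=
      (Real.contDiff_exp.comp (contDiff_const.mul contDiff_fst)).contDiffOn
    exact (h3.mul h2).congr fun p hp => hform p hp.2.2
  set M0 : ℝ := |Real.log ε| + |Real.log (max R 1)| with hM0
  have hM0n : 0 ≤ M0 := by positivity
  have hzero : ∀ p : ℝ × EuclideanSpace ℝ (Fin n), p.2 ≠ 0 → M0 < |p.1| → W p = 0 := by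
    intro p hp h
    have hx0 : 0 < ‖p.2‖ := norm_pos_iff.2 hp
    have hy : ‖Real.exp (-p.1) • ‖p.2‖⁻¹ • p.2‖ = Real.exp (-p.1) := by
      rw [norm_smul, norm_smul, norm_inv, norm_norm, inv_mul_cancel₀ hx0.ne', mul_one]
      exact Real.norm_of_nonneg (Real.exp_pos _).le
    rw [hform p hp]
    rcases lt_abs.1 h with h | h
    · rw [hue _, mul_zero]
      rw [hy, ← Real.lt_log_iff_exp_lt hε]
      have := neg_abs_le (Real.log ε)
      have := abs_nonneg (Real.log (max R 1))
      linarith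
    · rw [huR _, mul_zero]
      rw [hy]
      apply (le_max_left R 1).trans_lt
      rw [← Real.log_lt_iff_lt_exp (by positivity)]
      have := le_abs_self (Real.log (max R 1))
      have := abs_nonneg (Real.log ε)
      linarith
  have hsupp : ∀ p : ℝ × EuclideanSpace ℝ (Fin n), p.2 ∈ Ω → M0 + 1 ≤ |p.1| →
    W p = 0 ∧ fderiv ℝ W p = 0 ∧ fderiv ℝ (fderiv ℝ W) p = 0 := by
    intro p hp h
    have he : W =ᶠ[𝓝 p] fun _ => 0 := by
      have h1 : ∀ᶠ q : ℝ × EuclideanSpace ℝ (Fin n) in 𝓝 p, M0 < |q.1| :=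
        (continuous_abs.comp continuous_fst).continuousAt.eventually_const_lt
          (show M0 < |p.1| by linarith)
      filter_upwards [h1, hOo.mem_nhds (show p ∈ O from ⟨mem_univ _, hp⟩)] with q hq hqO
      exact hzero q (hΩ0 _ hqO.2) hq
    have he1 := he.fderiv (𝕜 := ℝ)
    have he2 := he1.fderiv (𝕜 := ℝ)
    refine ⟨he.eq_of_nhds, ?_, ?_⟩
    · rw [he1.eq_of_nhds]; simp
    · rw [he2.eq_of_nhds]; simp
  have hcomp : IsCompact (Icc (-(M0+1)) (M0+1) ×ˢ (closure Ω ∩ {x | 1 ≤ ‖x‖ ∧ ‖x‖ ≤ 2})) := by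
    apply isCompact_Icc.prod
    apply (isCompact_closedBall (0 : EuclideanSpace ℝ (Fin n)) 2).of_isClosed_subset
    · apply isClosed_closure.inter
      exact (isClosed_le continuous_const continuous_norm).inter
        (isClosed_le continuous_norm continuous_const)
    · intro x hx
      simpa using hx.2.2
  obtain ⟨B, hB0, hB⟩ := bdd_derivs hC hcomp (by
    intro p hp
    refine ⟨mem_univ _, hp.2.1, ?_⟩
    intro h0
    have h0 : p.2 = 0 := h0
    have := hp.2.2.1
    rw [h0] at this; norm_num at this) hOo hOA
  refine ⟨M0 + 1, B, ?_, ?_, ?_, ?_, hsupp, ?_, hB0, by positivity⟩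
  · intro p hp
    exact (hC.mono hOA).contDiffAt (hOo.mem_nhds ⟨mem_univ _, hp⟩)
  · intro s
    apply hC.continuousOn.comp (by fun_prop)
    intro x hx
    exact ⟨mem_univ _, hx⟩
  · intro s x hx hxn
    rw [hform (s, x) hx.2, hu0, mul_zero]
    have hr : 0 < ‖x‖⁻¹ := inv_pos.2 (norm_pos_iff.2 hx.2)
    rw [hΩo.frontier_eq]
    refine ⟨closure_coneOf_smul (Real.exp_pos _) (closure_coneOf_smul hr hx.1), ?_⟩
    simp only
    rwa [coneOf_smul (Real.exp_pos _), coneOf_smul hr]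
  · intro s r hr x
    simp only [hW]
    congr 2
    rw [norm_smul, smul_smul, Real.norm_of_nonneg hr.le, mul_inv]
    congr 1
    field_simp
  · intro p hp h1 h2
    by_cases h : M0 + 1 ≤ |p.1|
    · obtain ⟨a, b, c⟩ := hsupp p hp h
      rw [a, b, c, abs_zero]
      refine ⟨hB0, ?_, ?_⟩
      · rw [norm_zero]; exact hB0
      · exact (norm_zero (E := (ℝ × EuclideanSpace ℝ (Fin n)) →L[ℝ]
          (ℝ × EuclideanSpace ℝ (Fin n)) →L[ℝ] ℝ)).trans_le hB0
    · exact hB p ⟨⟨abs_le.1 (not_le.1 h).le, subset_closure hp, h1, h2⟩, mem_univ _, hp⟩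

open MeasureTheory Metric Set Filter
open scoped RealInnerProductSpace Topology

section slices
variable {n : ℕ} {F : ℝ × EuclideanSpace ℝ (Fin n) → ℝ}

theorem norm_clm_sq (T : EuclideanSpace ℝ (Fin n) →L[ℝ] ℝ) :
    ‖T‖ ^ 2 = ∑ i, T (EuclideanSpace.single i 1) ^ 2 := by
  set v := (InnerProductSpace.toDual ℝ (EuclideanSpace ℝ (Fin n))).symm T with hv
  have h1 : ‖T‖ = ‖v‖ := by rw [hv, LinearIsometryEquiv.norm_map]
  have h2 : ∀ y, T y = ⟪v, y⟫ := fun y => by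
    rw [hv, InnerProductSpace.toDual_symm_apply]
  rw [h1, EuclideanSpace.norm_sq_eq]
  apply Finset.sum_congr rfl
  intro i _
  rw [h2, EuclideanSpace.inner_single_right]
  simp

/-- s-derivative of `F` -/
theorem hasDerivAt_slice {G : Type*} [NormedAddCommGroup G] [NormedSpace ℝ G]
    {F : ℝ × EuclideanSpace ℝ (Fin n) → G} {p : ℝ × EuclideanSpace ℝ (Fin n)}
    (h : DifferentiableAt ℝ F p) :
    HasDerivAt (fun t => F (t, p.2)) (fderiv ℝ F p (1, 0)) p.1 := by
  have h1 : HasDerivAt (fun t : ℝ => (t, p.2)) ((1:ℝ), (0 : EuclideanSpace ℝ (Fin n))) p.1 :=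
    (hasDerivAt_id p.1).prodMk (hasDerivAt_const _ _)
  exact HasFDerivAt.comp_hasDerivAt (f := fun t : ℝ => (t, p.2)) p.1 h.hasFDerivAt h1

theorem hasFDerivAt_slice {G : Type*} [NormedAddCommGroup G] [NormedSpace ℝ G]
    {F : ℝ × EuclideanSpace ℝ (Fin n) → G} {p : ℝ × EuclideanSpace ℝ (Fin n)}
    (h : DifferentiableAt ℝ F p) :
    HasFDerivAt (fun x => F (p.1, x)) ((fderiv ℝ F p).comp (ContinuousLinearMap.inr ℝ ℝ _)) p.2 := by
  have h1 : HasFDerivAt (fun x : EuclideanSpace ℝ (Fin n) => (p.1, x))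
      (ContinuousLinearMap.inr ℝ ℝ _) p.2 := hasFDerivAt_prodMk_right p.1 p.2
  exact HasFDerivAt.comp (f := fun x => (p.1, x)) p.2 h.hasFDerivAt h1

theorem diff_of_contDiffAt {p : ℝ × EuclideanSpace ℝ (Fin n)} (h : ContDiffAt ℝ 2 F p) :
    DifferentiableAt ℝ F p := h.differentiableAt (by norm_num)

theorem diff2_of_contDiffAt {p : ℝ × EuclideanSpace ℝ (Fin n)} (h : ContDiffAt ℝ 2 F p) :
    DifferentiableAt ℝ (fderiv ℝ F) p :=
  (h.fderiv_right (m := 1) (by norm_num)).differentiableAt (by norm_num)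

theorem d2_symm {p : ℝ × EuclideanSpace ℝ (Fin n)} (h : ContDiffAt ℝ 2 F p)
    (a b : ℝ × EuclideanSpace ℝ (Fin n)) :
    fderiv ℝ (fderiv ℝ F) p a b = fderiv ℝ (fderiv ℝ F) p b a :=
  (h.isSymmSndFDerivAt (by simp)).eq a b

theorem fderiv_slice_apply {p : ℝ × EuclideanSpace ℝ (Fin n)} (h : ContDiffAt ℝ 2 F p)
    (v : EuclideanSpace ℝ (Fin n)) :
    fderiv ℝ (fun x => F (p.1, x)) p.2 v = fderiv ℝ F p (0, v) := by
  rw [(hasFDerivAt_slice (diff_of_contDiffAt h)).fderiv]; simp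

theorem contDiffAt_slice {p : ℝ × EuclideanSpace ℝ (Fin n)} (h : ContDiffAt ℝ 2 F p) :
    ContDiffAt ℝ 2 (fun x => F (p.1, x)) p.2 :=
  ContDiffAt.comp (f := fun x => (p.1, x)) (g := F) p.2 h
    (contDiffAt_const.prodMk contDiffAt_id)

theorem fderiv2_slice {p : ℝ × EuclideanSpace ℝ (Fin n)}
    {O : Set (EuclideanSpace ℝ (Fin n))} (hO : IsOpen O)
    (h : ∀ x ∈ O, ContDiffAt ℝ 2 F (p.1, x)) (hp : p.2 ∈ O) :
    fderiv ℝ (fderiv ℝ (fun x => F (p.1, x))) p.2 =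
      (ContinuousLinearMap.compL ℝ _ _ ℝ).flip (ContinuousLinearMap.inr ℝ ℝ _) ∘L
        ((fderiv ℝ (fderiv ℝ F) p).comp (ContinuousLinearMap.inr ℝ ℝ _)) := by
  have he : fderiv ℝ (fun x => F (p.1, x)) =ᶠ[𝓝 p.2] fun x =>
      (ContinuousLinearMap.compL ℝ (EuclideanSpace ℝ (Fin n)) (ℝ × EuclideanSpace ℝ (Fin n)) ℝ).flip
        (ContinuousLinearMap.inr ℝ ℝ _) (fderiv ℝ F (p.1, x)) := by
    filter_upwards [hO.mem_nhds hp] with x hx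
    exact (hasFDerivAt_slice (p := (p.1, x)) (diff_of_contDiffAt (h x hx))).fderiv
  rw [he.fderiv_eq]
  exact ((((ContinuousLinearMap.compL ℝ (EuclideanSpace ℝ (Fin n))
    (ℝ × EuclideanSpace ℝ (Fin n)) ℝ).flip
        (ContinuousLinearMap.inr ℝ ℝ _)).hasFDerivAt).comp p.2
    (hasFDerivAt_slice (F := fderiv ℝ F) (diff2_of_contDiffAt (h p.2 hp)))).fderiv

theorem fderiv2_slice_apply {p : ℝ × EuclideanSpace ℝ (Fin n)}
    {O : Set (EuclideanSpace ℝ (Fin n))} (hO : IsOpen O)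
    (h : ∀ x ∈ O, ContDiffAt ℝ 2 F (p.1, x)) (hp : p.2 ∈ O) (v v' : EuclideanSpace ℝ (Fin n)) :
    fderiv ℝ (fderiv ℝ (fun x => F (p.1, x))) p.2 v v' =
      fderiv ℝ (fderiv ℝ F) p (0, v) (0, v') := by
  rw [fderiv2_slice hO h hp]; simp

theorem hasFDerivAt_ds {p : ℝ × EuclideanSpace ℝ (Fin n)} (h : ContDiffAt ℝ 2 F p) :
    ∀ v, fderiv ℝ (fun x => fderiv ℝ F (p.1, x) (1, 0)) p.2 v =
      fderiv ℝ (fderiv ℝ F) p (1, 0) (0, v) := by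
  intro v
  have h1 := (ContinuousLinearMap.apply ℝ ℝ
    ((1, 0) : ℝ × EuclideanSpace ℝ (Fin n))).hasFDerivAt.comp p.2
    (hasFDerivAt_slice (diff2_of_contDiffAt h))
  have h2 : fderiv ℝ (fun x => fderiv ℝ F (p.1, x) (1, 0)) p.2 = _ := h1.fderiv
  rw [h2, d2_symm h]
  simp

theorem hasDerivAt_d1 {p : ℝ × EuclideanSpace ℝ (Fin n)} (h : ContDiffAt ℝ 2 F p)
    (v : ℝ × EuclideanSpace ℝ (Fin n)) :
    HasDerivAt (fun t => fderiv ℝ F (t, p.2) v) (fderiv ℝ (fderiv ℝ F) p (1, 0) v) p.1 := by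
  have := hasDerivAt_slice (diff2_of_contDiffAt h)
  exact (ContinuousLinearMap.apply ℝ ℝ v).hasFDerivAt.comp_hasDerivAt p.1 this
end slices

/-- partial derivative in s of the extension -/
noncomputable def fA {n : ℕ} (W : ℝ × EuclideanSpace ℝ (Fin n) → ℝ)
    (p : ℝ × EuclideanSpace ℝ (Fin n)) : ℝ := fderiv ℝ W p (1, 0)
/-- second partial derivative in s -/
noncomputable def fB {n : ℕ} (W : ℝ × EuclideanSpace ℝ (Fin n) → ℝ)
    (p : ℝ × EuclideanSpace ℝ (Fin n)) : ℝ := fderiv ℝ (fderiv ℝ W) p (1, 0) (1, 0)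
/-- Laplacian in x -/
noncomputable def fL {n : ℕ} (W : ℝ × EuclideanSpace ℝ (Fin n) → ℝ)
    (p : ℝ × EuclideanSpace ℝ (Fin n)) : ℝ :=
  ∑ i, fderiv ℝ (fderiv ℝ W) p (0, EuclideanSpace.single i 1) (0, EuclideanSpace.single i 1)
/-- gradient in x -/
noncomputable def fG {n : ℕ} (i : Fin n) (W : ℝ × EuclideanSpace ℝ (Fin n) → ℝ)
    (p : ℝ × EuclideanSpace ℝ (Fin n)) : ℝ := fderiv ℝ W p (0, EuclideanSpace.single i 1)
/-- mixed derivatives -/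
noncomputable def fH {n : ℕ} (i : Fin n) (W : ℝ × EuclideanSpace ℝ (Fin n) → ℝ)
    (p : ℝ × EuclideanSpace ℝ (Fin n)) : ℝ :=
  fderiv ℝ (fderiv ℝ W) p (1, 0) (0, EuclideanSpace.single i 1)

section ids
variable {n : ℕ} {S : Set (EuclideanSpace ℝ (Fin n))}
  {w : ℝ × EuclideanSpace ℝ (Fin n) → ℝ} {M B : ℝ}

theorem norm_of_mem (hS : IsSphDomain S) {σ : EuclideanSpace ℝ (Fin n)} (h : σ ∈ S) : ‖σ‖ = 1 := by
  simpa using hS.1 h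

theorem ws_ext (hW : CylOK S (fun p => w (p.1, ‖p.2‖⁻¹ • p.2)) M B)
    (s : ℝ) {x : EuclideanSpace ℝ (Fin n)} (hx : x ∈ coneOf S) :
    ws w (s, ‖x‖⁻¹ • x) = fA (fun p => w (p.1, ‖p.2‖⁻¹ • p.2)) (s, x) :=
  (hasDerivAt_slice (p := (s, x)) (diff_of_contDiffAt (hW.smooth (s, x) hx))).deriv

theorem ws_eq (hS : IsSphDomain S) (hW : CylOK S (fun p => w (p.1, ‖p.2‖⁻¹ • p.2)) M B)
    {p : ℝ × EuclideanSpace ℝ (Fin n)} (hp : p.2 ∈ S) :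
    ws w p = fA (fun p => w (p.1, ‖p.2‖⁻¹ • p.2)) p := by
  have := ws_ext hW p.1 (S_sub_cone hS hp)
  rwa [norm_of_mem hS hp, inv_one, one_smul] at this

theorem wss_eq (hS : IsSphDomain S) (hW : CylOK S (fun p => w (p.1, ‖p.2‖⁻¹ • p.2)) M B)
    {p : ℝ × EuclideanSpace ℝ (Fin n)} (hp : p.2 ∈ S) :
    wss w p = fB (fun p => w (p.1, ‖p.2‖⁻¹ • p.2)) p := by
  have h1 : (fun t => ws w (t, p.2)) = fun t => fA (fun p => w (p.1, ‖p.2‖⁻¹ • p.2)) (t, p.2) :=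
    funext fun t => ws_eq hS hW hp
  rw [wss, h1]
  exact (hasDerivAt_d1 (hW.smooth p (S_sub_cone hS hp)) (1, 0)).deriv

theorem lap_slice_eq (hS : IsSphDomain S) {W : ℝ × EuclideanSpace ℝ (Fin n) → ℝ}
    (hW : CylOK S W M B)
    {p : ℝ × EuclideanSpace ℝ (Fin n)} (hp : p.2 ∈ coneOf S) :
    lap (fun x => W (p.1, x)) p.2 = fL W p := by
  rw [lap_eq]
  apply Finset.sum_congr rfl
  intro i _
  exact fderiv2_slice_apply hS.isOpen_cone (fun x hx => hW.smooth (p.1, x) hx) hp _ _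

theorem sphLap_eq (hS : IsSphDomain S) (hW : CylOK S (fun p => w (p.1, ‖p.2‖⁻¹ • p.2)) M B)
    {p : ℝ × EuclideanSpace ℝ (Fin n)} (hp : p.2 ∈ S) :
    sphLap (fun y => w (p.1, y)) p.2 = fL (fun p => w (p.1, ‖p.2‖⁻¹ • p.2)) p :=
  lap_slice_eq hS hW (S_sub_cone hS hp)

theorem sphGrad_eq (hS : IsSphDomain S) (hW : CylOK S (fun p => w (p.1, ‖p.2‖⁻¹ • p.2)) M B)
    {p : ℝ × EuclideanSpace ℝ (Fin n)} (hp : p.2 ∈ S) :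
    sphGradNormSq (fun y => ws w (p.1, y)) p.2 =
      ∑ i, fH i (fun p => w (p.1, ‖p.2‖⁻¹ • p.2)) p ^ 2 := by
  have hp' := S_sub_cone hS hp
  have he : (fun x => ws w (p.1, ‖x‖⁻¹ • x)) =ᶠ[𝓝 p.2]
      fun x => fA (fun p => w (p.1, ‖p.2‖⁻¹ • p.2)) (p.1, x) := by
    filter_upwards [hS.isOpen_cone.mem_nhds hp'] with x hx
    exact ws_ext hW p.1 hx
  rw [sphGradNormSq, he.fderiv_eq, norm_clm_sq]
  apply Finset.sum_congr rfl
  intro i _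
  congr 1
  exact hasFDerivAt_ds (hW.smooth p hp') _
end ids

open MeasureTheory Metric Set Filter
open scoped RealInnerProductSpace Topology

theorem line_calc {n : ℕ} {κ : ℝ} {u : EuclideanSpace ℝ (Fin n) → ℝ}
    {W : ℝ × EuclideanSpace ℝ (Fin n) → ℝ} {x e : EuclideanSpace ℝ (Fin n)} {l l1 : ℝ → ℝ} {l2 : ℝ}
    (hu : ∀ᶠ t : ℝ in 𝓝 0, ContDiffAt ℝ 2 u (x + t • e))
    (hW : ∀ᶠ t : ℝ in 𝓝 0, ContDiffAt ℝ 2 W (-l t, x + t • e))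
    (hl : ∀ᶠ t : ℝ in 𝓝 0, HasDerivAt l (l1 t) t)
    (hl1 : HasDerivAt l1 l2 0)
    (huW : ∀ᶠ t : ℝ in 𝓝 0, u (x + t • e) = Real.exp (κ * l t) * W (-l t, x + t • e)) :
    fderiv ℝ (fderiv ℝ u) x e e = Real.exp (κ * l 0) * (
      (κ ^ 2 * l1 0 ^ 2 + κ * l2) * W (-l 0, x)
      + 2 * κ * l1 0 * fderiv ℝ W (-l 0, x) (-l1 0, e)
      + fderiv ℝ (fderiv ℝ W) (-l 0, x) (-l1 0, e) (-l1 0, e)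
      + fderiv ℝ W (-l 0, x) (-l2, 0)) := by
  have hline : ∀ t : ℝ, HasDerivAt (fun t : ℝ => x + t • e) e t := by
    intro t
    simpa using ((hasDerivAt_id t).smul_const e).const_add x
  have hz : ∀ t, HasDerivAt l (l1 t) t →
      HasDerivAt (fun t => (-l t, x + t • e)) (-l1 t, e) t :=
    fun t h => h.neg.prodMk (hline t)
  have hexp : ∀ t, HasDerivAt l (l1 t) t →
      HasDerivAt (fun t => Real.exp (κ * l t)) (Real.exp (κ * l t) * (κ * l1 t)) t :=
    fun t h => (h.const_mul κ).exp
  have h1 : ∀ t, HasDerivAt l (l1 t) t → ContDiffAt ℝ 2 W (-l t, x + t • e) →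
      HasDerivAt (fun t => W (-l t, x + t • e)) (fderiv ℝ W (-l t, x + t • e) (-l1 t, e)) t := by
    intro t h h'
    exact HasFDerivAt.comp_hasDerivAt (f := fun t => (-l t, x + t • e)) t
      (diff_of_contDiffAt h').hasFDerivAt (hz t h)
  have hev : (fun t => fderiv ℝ u (x + t • e) e) =ᶠ[𝓝 0] fun t =>
      Real.exp (κ * l t) * (κ * l1 t) * W (-l t, x + t • e) +
        Real.exp (κ * l t) * fderiv ℝ W (-l t, x + t • e) (-l1 t, e) := by
    filter_upwards [hu, hW, hl, huW.eventually_nhds] with t a b c d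
    have e1 : HasDerivAt (fun t => u (x + t • e)) (fderiv ℝ u (x + t • e) e) t :=
      HasFDerivAt.comp_hasDerivAt (f := fun t => x + t • e) t
        (a.differentiableAt (by norm_num)).hasFDerivAt (hline t)
    have e2 := ((hexp t c).mul (h1 t c b)).congr_of_eventuallyEq d
    exact e1.unique e2
  have hu0 := hu.self_of_nhds
  have hW0 := hW.self_of_nhds
  have hl0 := hl.self_of_nhds
  have hx0 : x + (0:ℝ) • e = x := by simp
  have hA : HasDerivAt (fun t : ℝ => fderiv ℝ u (x + t • e) e) (fderiv ℝ (fderiv ℝ u) x e e) 0 := by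
    have h2 : DifferentiableAt ℝ (fderiv ℝ u) (x + (0:ℝ) • e) :=
      (hu0.fderiv_right (m := 1) (by norm_num)).differentiableAt (by norm_num)
    have h3 := HasFDerivAt.comp_hasDerivAt (f := fun t : ℝ => x + t • e) 0 h2.hasFDerivAt (hline 0)
    have h4 := (ContinuousLinearMap.apply ℝ ℝ e).hasFDerivAt.comp_hasDerivAt (0:ℝ) h3
    rw [hx0] at h4
    exact h4
  have hB1 : HasDerivAt (fun t => fderiv ℝ W (-l t, x + t • e))
      (fderiv ℝ (fderiv ℝ W) (-l 0, x + (0:ℝ) • e) (-l1 0, e)) 0 :=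
    HasFDerivAt.comp_hasDerivAt (f := fun t => (-l t, x + t • e)) (0:ℝ)
      (diff2_of_contDiffAt hW0).hasFDerivAt (hz 0 hl0)
  have hz1 : HasDerivAt (fun t => ((-l1 t, e) : ℝ × EuclideanSpace ℝ (Fin n))) (-l2, 0) 0 :=
    hl1.neg.prodMk (hasDerivAt_const _ _)
  have hB2 := hB1.clm_apply hz1
  have hB := (((hexp 0 hl0).mul (hl1.const_mul κ)).mul (h1 0 hl0 hW0)).add
    ((hexp 0 hl0).mul hB2)
  have := hA.unique (hB.congr_of_eventuallyEq hev)
  rw [this]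
  simp only [hx0, Pi.mul_apply]
  ring

theorem lap_formula {n : ℕ} {κ : ℝ} {S : Set (EuclideanSpace ℝ (Fin n))} (hS : IsSphDomain S)
    {u : EuclideanSpace ℝ (Fin n) → ℝ} (hu : ∀ x ∈ coneOf S, ContDiffAt ℝ 2 u x)
    {W : ℝ × EuclideanSpace ℝ (Fin n) → ℝ} {M B : ℝ} (hW : CylOK S W M B)
    (huW : ∀ x ∈ coneOf S, u x = ‖x‖ ^ κ * W (-Real.log ‖x‖, x))
    {x : EuclideanSpace ℝ (Fin n)} (hx : x ∈ coneOf S) :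
    ‖x‖ ^ 2 * lap u x = ‖x‖ ^ κ * (κ * (κ + n - 2) * W (-Real.log ‖x‖, x)
      - (2 * κ + n - 2) * fA W (-Real.log ‖x‖, x) + fB W (-Real.log ‖x‖, x)
      + ‖x‖ ^ 2 * fL W (-Real.log ‖x‖, x)) := by
  have hx0 : 0 < ‖x‖ := norm_pos_iff.2 hx.1
  set ρ := ‖x‖ with hρ
  set s := -Real.log ρ with hs
  have hWx := hW.smooth (s, x) hx
  -- second derivative in each direction
  have key : ∀ i : Fin n, fderiv ℝ (fderiv ℝ u) x (EuclideanSpace.single i 1)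
      (EuclideanSpace.single i 1) = ρ ^ κ * (
      (κ ^ 2 * (x i / ρ ^ 2) ^ 2 + κ * ((ρ ^ 2 - 2 * x i ^ 2) / ρ ^ 4)) * W (s, x)
      + 2 * κ * (x i / ρ ^ 2) * fderiv ℝ W (s, x) (-(x i / ρ ^ 2), EuclideanSpace.single i 1)
      + fderiv ℝ (fderiv ℝ W) (s, x) (-(x i / ρ ^ 2), EuclideanSpace.single i 1)
          (-(x i / ρ ^ 2), EuclideanSpace.single i 1)
      + fderiv ℝ W (s, x) (-((ρ ^ 2 - 2 * x i ^ 2) / ρ ^ 4), 0)) := by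
    intro i
    set e : EuclideanSpace ℝ (Fin n) := EuclideanSpace.single i 1 with he
    set a := x i with ha
    let q : ℝ → ℝ := fun t => ρ ^ 2 + 2 * t * a + t ^ 2
    have hq : ∀ t : ℝ, ‖x + t • e‖ ^ 2 = q t := by
      intro t
      rw [norm_add_sq_real, inner_smul_right, he, EuclideanSpace.inner_single_right, norm_smul,
        EuclideanSpace.norm_single, ← hρ]
      simp [q, ← ha]
      ring
    have hqd : ∀ t, HasDerivAt q (2 * a + 2 * t) t := by
      intro t
      have h1 : HasDerivAt (fun t : ℝ => ρ ^ 2 + 2 * t * a) (2 * a) t := by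
        simpa using (((hasDerivAt_id t).const_mul 2).mul_const a).const_add (ρ ^ 2)
      have h2 : HasDerivAt (fun t : ℝ => t ^ 2) (2 * t) t := by
        simpa using hasDerivAt_pow 2 t
      exact h1.add h2
    have hq0 : q 0 = ρ ^ 2 := by simp [q]
    let l : ℝ → ℝ := fun t => (1/2) * Real.log (q t)
    let l1 : ℝ → ℝ := fun t => (a + t) / q t
    have hll : ∀ t, l t = Real.log ‖x + t • e‖ := by
      intro t
      simp only [l, ← hq, Real.log_pow]; push_cast; ring
    have hl0 : -l 0 = s := by rw [hll]; simp [hs, hρ]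
    have hmem : ∀ᶠ t : ℝ in 𝓝 0, x + t • e ∈ coneOf S := by
      have hc : ContinuousAt (fun t : ℝ => x + t • e) 0 := by fun_prop
      apply hc.eventually_mem
      apply hS.isOpen_cone.mem_nhds
      simpa using hx
    have hqpos : ∀ᶠ t : ℝ in 𝓝 0, 0 < q t := by
      filter_upwards [hmem] with t ht
      rw [← hq]
      have := norm_pos_iff.2 ht.1
      positivity
    have h := line_calc (κ := κ) (u := u) (W := W) (x := x) (e := e) (l := l) (l1 := l1)
      (l2 := (ρ ^ 2 - 2 * a ^ 2) / ρ ^ 4)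
      (by filter_upwards [hmem] with t ht using hu _ ht)
      (by filter_upwards [hmem] with t ht using hW.smooth _ ht)
      (by
        filter_upwards [hqpos] with t ht
        have := ((hqd t).log ht.ne').const_mul (1/2)
        refine this.congr_deriv ?_
        simp only [l1]
        field_simp)
      (by
        have h1 : HasDerivAt (fun t : ℝ => a + t) 1 0 := by
          simpa using (hasDerivAt_id (0:ℝ)).const_add a
        have := h1.div (hqd 0) (by rw [hq0]; positivity)
        refine this.congr_deriv ?_
        rw [hq0]
        field_simp
        ring)
      (by
        filter_upwards [hmem] with t ht
        rw [huW _ ht, hll]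
        congr 1
        rw [Real.rpow_def_of_pos (norm_pos_iff.2 ht.1), mul_comm])
    rw [h, hl0]
    have hk : Real.exp (κ * l 0) = ρ ^ κ := by
      rw [Real.rpow_def_of_pos hx0, mul_comm (Real.log ρ), hll]; simp [hρ]
    have hl10 : l1 0 = a / ρ ^ 2 := by simp [l1, hq0]
    rw [hk, hl10]
  have hpair : ∀ (c : ℝ) (v : EuclideanSpace ℝ (Fin n)),
      ((c, v) : ℝ × EuclideanSpace ℝ (Fin n)) = c • ((1:ℝ), (0 : EuclideanSpace ℝ (Fin n))) + (0, v) := by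
    intro c v; simp
  have hpair0 : ∀ (c : ℝ),
      ((c, 0) : ℝ × EuclideanSpace ℝ (Fin n)) = c • ((1:ℝ), (0 : EuclideanSpace ℝ (Fin n))) := by
    intro c; simp
  -- radial derivatives vanish
  have hrad : ∑ i, x i * fG i W (s, x) = 0 := by
    have h1 := fderiv_radial (hW.homog s) ((contDiffAt_slice hWx).differentiableAt (by norm_num))
    rw [← clm_sum_single] at h1
    rw [← h1]
    apply Finset.sum_congr rfl
    intro i _
    rw [fderiv_slice_apply (p := (s, x)) hWx]; rfl
  have hradH : ∑ i, x i * fH i W (s, x) = 0 := by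
    have h2 : ∀ t, fderiv ℝ W (t, x) (0, x) = 0 := by
      intro t
      have hWt := hW.smooth (t, x) hx
      rw [← fderiv_slice_apply (p := (t, x)) hWt]
      exact fderiv_radial (hW.homog t) ((contDiffAt_slice hWt).differentiableAt (by norm_num))
    have h3 := hasDerivAt_d1 hWx (0, x)
    have h4 : (fun t => fderiv ℝ W (t, (s, x).2) (0, x)) = fun _ => (0:ℝ) := funext h2
    rw [h4] at h3
    have h5 := h3.unique (hasDerivAt_const s (0:ℝ))
    rw [← h5]
    have := clm_sum_single ((fderiv ℝ (fderiv ℝ W) (s, x) (1, 0)).comp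
      (ContinuousLinearMap.inr ℝ ℝ _)) x
    simpa [fH] using this
  have hsq : ∑ i, x i ^ 2 = ρ ^ 2 := by
    rw [hρ, EuclideanSpace.norm_sq_eq]; simp
  have key2 : ∀ i : Fin n, ρ ^ 2 * fderiv ℝ (fderiv ℝ u) x (EuclideanSpace.single i 1)
      (EuclideanSpace.single i 1) = ρ ^ κ * (
        κ ^ 2 / ρ ^ 2 * W (s, x) * x i ^ 2 + (κ * W (s, x) - fA W (s, x)) * (1 - 2 / ρ ^ 2 * x i ^ 2)
        - 2 * κ / ρ ^ 2 * fA W (s, x) * x i ^ 2 + 2 * κ * (x i * fG i W (s, x))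
        + 1 / ρ ^ 2 * fB W (s, x) * x i ^ 2
        - 2 * (x i * fH i W (s, x)) + ρ ^ 2 * fderiv ℝ (fderiv ℝ W) (s, x)
          (0, EuclideanSpace.single i 1) (0, EuclideanSpace.single i 1)) := by
    intro i
    rw [key i, hpair0 (-((ρ ^ 2 - 2 * x i ^ 2) / ρ ^ 4)),
      hpair (-(x i / ρ ^ 2)) (EuclideanSpace.single i 1)]
    simp only [map_add, map_smul, _root_.add_apply, _root_.smul_apply,
      smul_eq_mul]
    rw [d2_symm hWx (0, EuclideanSpace.single i 1) (1, 0)]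
    simp only [fA, fB, fG, fH]
    field_simp
    ring
  rw [lap_eq, Finset.mul_sum, Finset.sum_congr rfl (fun i _ => key2 i), ← Finset.mul_sum]
  congr 1
  simp only [Finset.sum_add_distrib, Finset.sum_sub_distrib, ← Finset.mul_sum, hrad, hradH, hsq,
    mul_zero, Finset.sum_const, Finset.card_univ, Fintype.card_fin, nsmul_eq_mul, mul_one, fL]
  field_simp
  ring

open MeasureTheory Metric Set Filter
open scoped RealInnerProductSpace Topology

/-- surface measure on `S` -/
noncomputable def nuS {n : ℕ} (S : Set (EuclideanSpace ℝ (Fin n))) :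
    Measure (EuclideanSpace ℝ (Fin n)) := (sphMeasure n).restrict S

/-- cylinder measure -/
noncomputable def muS {n : ℕ} (S : Set (EuclideanSpace ℝ (Fin n))) :
    Measure (ℝ × EuclideanSpace ℝ (Fin n)) := (volume : Measure ℝ).prod (nuS S)

instance nuS_finite {n : ℕ} (S : Set (EuclideanSpace ℝ (Fin n))) : IsFiniteMeasure (nuS S) := by
  unfold nuS; infer_instance

theorem muS_eq {n : ℕ} (S : Set (EuclideanSpace ℝ (Fin n))) :
    muS S = ((volume : Measure ℝ).prod (sphMeasure n)).restrict (univ ×ˢ S) := by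
  rw [muS, nuS, ← Measure.prod_restrict, Measure.restrict_univ]

/-- bounded and continuous on the cylinder -/
structure BC {n : ℕ} (S : Set (EuclideanSpace ℝ (Fin n)))
    (f : ℝ × EuclideanSpace ℝ (Fin n) → ℝ) : Prop where
  cont : ContinuousOn f (univ ×ˢ S)
  bdd : ∃ C, ∀ p, p.2 ∈ S → |f p| ≤ C

/-- bounded, continuous and compactly supported on the cylinder -/
structure Good {n : ℕ} (S : Set (EuclideanSpace ℝ (Fin n))) (M : ℝ)
    (f : ℝ × EuclideanSpace ℝ (Fin n) → ℝ) : Prop extends BC S f where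
  supp : ∀ p, p.2 ∈ S → M ≤ |p.1| → f p = 0

section good
variable {n : ℕ} {S : Set (EuclideanSpace ℝ (Fin n))} {M : ℝ}
  {f g : ℝ × EuclideanSpace ℝ (Fin n) → ℝ}

theorem BC.mul (hf : BC S f) (hg : BC S g) : BC S (fun p => f p * g p) := by
  obtain ⟨C, hC⟩ := hf.bdd
  obtain ⟨D, hD⟩ := hg.bdd
  refine ⟨hf.cont.mul hg.cont, C * D, fun p hp => ?_⟩
  rw [abs_mul]
  exact mul_le_mul (hC p hp) (hD p hp) (abs_nonneg _) ((abs_nonneg _).trans (hC p hp))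

theorem BC.add (hf : BC S f) (hg : BC S g) : BC S (fun p => f p + g p) := by
  obtain ⟨C, hC⟩ := hf.bdd
  obtain ⟨D, hD⟩ := hg.bdd
  refine ⟨hf.cont.add hg.cont, C + D, fun p hp => ?_⟩
  exact (abs_add_le _ _).trans (add_le_add (hC p hp) (hD p hp))

theorem BC.shift (hf : BC S f) (a : ℝ) : BC S (fun p => f (p.1 + a, p.2)) := by
  obtain ⟨C, hC⟩ := hf.bdd
  refine ⟨hf.cont.comp (by fun_prop) fun p hp => ⟨mem_univ _, hp.2⟩, C, fun p hp => hC _ hp⟩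

theorem Good.mul_left (hf : BC S f) (hg : Good S M g) : Good S M (fun p => f p * g p) :=
  ⟨hf.mul hg.toBC, fun p hp h => by simp [hg.supp p hp h]⟩

theorem Good.mul (hf : Good S M f) (hg : Good S M g) : Good S M (fun p => f p * g p) :=
  Good.mul_left hf.toBC hg

theorem Good.add (hf : Good S M f) (hg : Good S M g) : Good S M (fun p => f p + g p) :=
  ⟨hf.toBC.add hg.toBC, fun p hp h => by simp [hg.supp p hp h, hf.supp p hp h]⟩

theorem Good.const_mul (c : ℝ) (hg : Good S M g) : Good S M (fun p => c * g p) :=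
  Good.mul_left (f := fun _ => c) ⟨continuousOn_const, |c|, fun _ _ => le_rfl⟩ hg

theorem Good.sq (hg : Good S M g) : Good S M (fun p => g p ^ 2) := by
  simpa only [pow_two] using hg.mul hg

theorem Good.zero : Good S M (fun _ => 0) :=
  ⟨⟨continuousOn_const, 0, fun _ _ => by simp⟩, fun _ _ _ => rfl⟩

theorem Good.sum {ι : Type*} (t : Finset ι) {F : ι → ℝ × EuclideanSpace ℝ (Fin n) → ℝ}
    (h : ∀ i, Good S M (F i)) : Good S M (fun p => ∑ i ∈ t, F i p) := by
  classical
  induction t using Finset.induction_on with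
  | empty => simpa using Good.zero
  | insert a t ha ih =>
    simp only [Finset.sum_insert ha]
    exact (h a).add ih

theorem ae_muS (hS : MeasurableSet S) : ∀ᵐ p ∂(muS S), p.2 ∈ S := by
  rw [muS_eq]
  filter_upwards [ae_restrict_mem (MeasurableSet.univ.prod hS)] with p hp using hp.2

theorem ae_nuS (hS : MeasurableSet S) : ∀ᵐ p ∂(nuS S), p ∈ S := ae_restrict_mem hS

theorem BC.aesm (hS : MeasurableSet S) (hf : BC S f) : AEStronglyMeasurable f (muS S) := by
  rw [muS_eq]
  exact hf.cont.aestronglyMeasurable (MeasurableSet.univ.prod hS)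

theorem Good.integrable (hS : MeasurableSet S) (hf : Good S M f) : Integrable f (muS S) := by
  obtain ⟨C, hC⟩ := hf.bdd
  have hfin : muS S (Icc (-M) M ×ˢ univ) < ⊤ := by
    rw [muS, Measure.prod_prod]
    exact ENNReal.mul_lt_top (by simp) (measure_lt_top _ _)
  have hi : Integrable ((Icc (-M) M ×ˢ (univ : Set (EuclideanSpace ℝ (Fin n)))).indicator
      fun _ => C) (muS S) :=
    (integrable_indicator_iff (measurableSet_Icc.prod MeasurableSet.univ)).2
      (integrableOn_const hfin.ne)
  apply hi.mono' (hf.aesm hS)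
  filter_upwards [ae_muS hS] with p hp
  by_cases h : M ≤ |p.1|
  · rw [hf.supp p hp h, norm_zero]
    apply indicator_nonneg
    intro _ _
    exact (abs_nonneg _).trans (hC p hp)
  · rw [indicator_of_mem]
    · exact hC p hp
    · exact ⟨abs_le.1 (not_le.1 h).le, mem_univ _⟩

theorem BC.slice_integrable (hS : MeasurableSet S) (hf : BC S f) (s : ℝ) :
    Integrable (fun x => f (s, x)) (nuS S) := by
  obtain ⟨C, hC⟩ := hf.bdd
  have h1 : ContinuousOn (fun x => f (s, x)) S :=
    hf.cont.comp (by fun_prop) fun x hx => ⟨mem_univ _, hx⟩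
  apply Integrable.mono' (integrable_const C) (h1.aestronglyMeasurable hS)
  filter_upwards [ae_nuS hS] with x hx using hC (s, x) hx

theorem Good.line (hf : Good S M f) {x : EuclideanSpace ℝ (Fin n)} (hx : x ∈ S) :
    Integrable (fun t => f (t, x)) := by
  have hc : Continuous (fun t => f (t, x)) := by
    rw [← continuousOn_univ]
    exact hf.cont.comp (by fun_prop) fun t _ => ⟨mem_univ _, hx⟩
  apply hc.integrable_of_hasCompactSupport
  apply HasCompactSupport.intro (isCompact_Icc (a := -M) (b := M))
  intro t ht
  apply hf.supp (t, x) hx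
  by_contra h
  exact ht (abs_le.1 (not_le.1 h).le)

theorem Good.ftc (hS : MeasurableSet S) (hf : Good S M f) (hg : Good S M g)
    (hd : ∀ p, p.2 ∈ S → HasDerivAt (fun t => f (t, p.2)) (g p) p.1) :
    ∫ p, g p ∂(muS S) = 0 := by
  have hi := hg.integrable hS
  rw [muS] at hi ⊢
  rw [integral_prod_symm _ hi]
  apply integral_eq_zero_of_ae
  filter_upwards [ae_nuS hS] with x hx
  exact integral_eq_zero_of_hasDerivAt_of_integrable (fun t => hd (t, x) hx) (hg.line hx)
    (hf.line hx)

theorem integral_shift (F : ℝ × EuclideanSpace ℝ (Fin n) → ℝ) (a : ℝ) :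
    ∫ p, F (p.1 + a, p.2) ∂(muS S) = ∫ p, F p ∂(muS S) := by
  have h1 : MeasurePreserving (fun t : ℝ => t + a) volume volume :=
    measurePreserving_add_right volume a
  have h2 := h1.prod (MeasurePreserving.id (nuS S))
  let e : (ℝ × EuclideanSpace ℝ (Fin n)) ≃ᵐ (ℝ × EuclideanSpace ℝ (Fin n)) :=
    (MeasurableEquiv.addRight a).prodCongr (MeasurableEquiv.refl _)
  have h3 : MeasurePreserving e (muS S) (muS S) := h2
  exact h3.integral_comp' F

theorem Good.hasDeriv_shift (hS : MeasurableSet S) {f' : ℝ × EuclideanSpace ℝ (Fin n) → ℝ}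
    (hf : BC S f) (hf' : BC S f') (hg : Good S M g)
    (hd : ∀ p, p.2 ∈ S → HasDerivAt (fun t => f (t, p.2)) (f' p) p.1) (a : ℝ) :
    HasDerivAt (fun a => ∫ p, f (p.1 + a, p.2) * g p ∂(muS S))
      (∫ p, f' (p.1 + a, p.2) * g p ∂(muS S)) a := by
  obtain ⟨C, hC⟩ := hf'.bdd
  refine (hasDerivAt_integral_of_dominated_loc_of_deriv_le (μ := muS S)
    (F := fun a p => f (p.1 + a, p.2) * g p) (F' := fun a p => f' (p.1 + a, p.2) * g p)
    (bound := fun p => C * |g p|) (s := univ) (x₀ := a) univ_mem ?_ ?_ ?_ ?_ ?_ ?_).2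
  · exact Eventually.of_forall fun a => ((hf.shift a).mul hg.toBC).aesm hS
  · exact (Good.mul_left (hf.shift a) hg).integrable hS
  · exact ((hf'.shift a).mul hg.toBC).aesm hS
  · filter_upwards [ae_muS hS] with p hp b _
    rw [Real.norm_eq_abs, abs_mul]
    exact mul_le_mul_of_nonneg_right (hC _ hp) (abs_nonneg _)
  · exact (hg.integrable hS).abs.const_mul C
  · filter_upwards [ae_muS hS] with p hp b _
    have h1 := hd (p.1 + b, p.2) hp
    exact (HasDerivAt.comp_const_add p.1 b h1).mul_const _
end good

open MeasureTheory Metric Set Filter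
open scoped RealInnerProductSpace Topology

section cyl
variable {n : ℕ} {S : Set (EuclideanSpace ℝ (Fin n))} {M B : ℝ}
  {W : ℝ × EuclideanSpace ℝ (Fin n) → ℝ}

theorem CylOK.bound' (hS : IsSphDomain S) (hW : CylOK S W M B)
    {p : ℝ × EuclideanSpace ℝ (Fin n)} (hp : p.2 ∈ S) :
    |W p| ≤ B ∧ ‖fderiv ℝ W p‖ ≤ B ∧ ‖fderiv ℝ (fderiv ℝ W) p‖ ≤ B :=
  hW.bound p (S_sub_cone hS hp) (norm_of_mem hS hp).ge (by rw [norm_of_mem hS hp]; norm_num)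

theorem CylOK.goodW (hS : IsSphDomain S) (hW : CylOK S W M B) : Good S M W :=
  ⟨⟨fun p hp => (hW.smooth p (S_sub_cone hS hp.2)).continuousAt.continuousWithinAt, B,
    fun _ hp => (hW.bound' hS hp).1⟩, fun p hp h => (hW.supp p (S_sub_cone hS hp) h).1⟩

theorem CylOK.good1 (hS : IsSphDomain S) (hW : CylOK S W M B)
    (v : ℝ × EuclideanSpace ℝ (Fin n)) : Good S M (fun p => fderiv ℝ W p v) := by
  refine ⟨⟨fun p hp => ?_, B * ‖v‖, fun p hp => ?_⟩, fun p hp h => ?_⟩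
  · have h1 : ContinuousAt (fderiv ℝ W) p :=
      (diff2_of_contDiffAt (hW.smooth p (S_sub_cone hS hp.2))).continuousAt
    exact (h1.clm_apply continuousAt_const).continuousWithinAt
  · exact (ContinuousLinearMap.le_opNorm _ _).trans
      (mul_le_mul_of_nonneg_right (hW.bound' hS hp).2.1 (norm_nonneg _))
  · simp [(hW.supp p (S_sub_cone hS hp) h).2.1]

theorem CylOK.good2 (hS : IsSphDomain S) (hW : CylOK S W M B)
    (v v' : ℝ × EuclideanSpace ℝ (Fin n)) :
    Good S M (fun p => fderiv ℝ (fderiv ℝ W) p v v') := by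
  refine ⟨⟨fun p hp => ?_, B * ‖v‖ * ‖v'‖, fun p hp => ?_⟩, fun p hp h => ?_⟩
  · have h0 : ContDiffAt ℝ 1 (fderiv ℝ W) p :=
      (hW.smooth p (S_sub_cone hS hp.2)).fderiv_right (by norm_num)
    have h1 : ContinuousAt (fderiv ℝ (fderiv ℝ W)) p :=
      (h0.fderiv_right (m := 0) (by norm_num)).continuousAt
    exact ((h1.clm_apply continuousAt_const).clm_apply continuousAt_const).continuousWithinAt
  · exact (ContinuousLinearMap.le_opNorm₂ _ _ _).trans
      (mul_le_mul_of_nonneg_right (mul_le_mul_of_nonneg_right (hW.bound' hS hp).2.2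
        (norm_nonneg _)) (norm_nonneg _))
  · simp [(hW.supp p (S_sub_cone hS hp) h).2.2]

theorem CylOK.goodA (hS : IsSphDomain S) (hW : CylOK S W M B) : Good S M (fA W) := hW.good1 hS _
theorem CylOK.goodG (hS : IsSphDomain S) (hW : CylOK S W M B) (i : Fin n) : Good S M (fG i W) :=
  hW.good1 hS _
theorem CylOK.goodB (hS : IsSphDomain S) (hW : CylOK S W M B) : Good S M (fB W) := hW.good2 hS _ _
theorem CylOK.goodH (hS : IsSphDomain S) (hW : CylOK S W M B) (i : Fin n) : Good S M (fH i W) :=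
  hW.good2 hS _ _
theorem CylOK.goodL (hS : IsSphDomain S) (hW : CylOK S W M B) : Good S M (fL W) :=
  Good.sum _ fun _ => hW.good2 hS _ _

theorem CylOK.dW (hS : IsSphDomain S) (hW : CylOK S W M B)
    (p : ℝ × EuclideanSpace ℝ (Fin n)) (hp : p.2 ∈ S) :
    HasDerivAt (fun t => W (t, p.2)) (fA W p) p.1 :=
  hasDerivAt_slice (diff_of_contDiffAt (hW.smooth p (S_sub_cone hS hp)))
theorem CylOK.dA (hS : IsSphDomain S) (hW : CylOK S W M B)
    (p : ℝ × EuclideanSpace ℝ (Fin n)) (hp : p.2 ∈ S) :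
    HasDerivAt (fun t => fA W (t, p.2)) (fB W p) p.1 :=
  hasDerivAt_d1 (hW.smooth p (S_sub_cone hS hp)) _
theorem CylOK.dG (hS : IsSphDomain S) (hW : CylOK S W M B) (i : Fin n)
    (p : ℝ × EuclideanSpace ℝ (Fin n)) (hp : p.2 ∈ S) :
    HasDerivAt (fun t => fG i W (t, p.2)) (fH i W p) p.1 :=
  hasDerivAt_d1 (hW.smooth p (S_sub_cone hS hp)) _

theorem CylOK.slice_bound (hS : IsSphDomain S) (hW : CylOK S W M B)
    {p : ℝ × EuclideanSpace ℝ (Fin n)} (hp : p.2 ∈ coneOf S) (h1 : 1 ≤ ‖p.2‖) (h2 : ‖p.2‖ ≤ 2) :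
    ‖fderiv ℝ (fun x => W (p.1, x)) p.2‖ ≤ B ∧
    ‖fderiv ℝ (fderiv ℝ (fun x => W (p.1, x))) p.2‖ ≤ B := by
  obtain ⟨-, hb, hc⟩ := hW.bound p hp h1 h2
  have hpn : ∀ v : EuclideanSpace ℝ (Fin n), ‖((0:ℝ), v)‖ = ‖v‖ := fun v => by
    rw [Prod.norm_mk]; simp
  constructor
  · refine ContinuousLinearMap.opNorm_le_bound _ hW.Bnonneg fun v => ?_
    rw [fderiv_slice_apply (hW.smooth p hp), ← hpn v]
    exact (ContinuousLinearMap.le_opNorm _ _).trans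
      (mul_le_mul_of_nonneg_right hb (norm_nonneg _))
  · refine ContinuousLinearMap.opNorm_le_bound₂ _ hW.Bnonneg fun v v' => ?_
    rw [fderiv2_slice_apply hS.isOpen_cone (fun x hx => hW.smooth (p.1, x) hx) hp,
      ← hpn v, ← hpn v']
    exact (ContinuousLinearMap.le_opNorm₂ _ _ _).trans
      (mul_le_mul_of_nonneg_right (mul_le_mul_of_nonneg_right hc (norm_nonneg _)) (norm_nonneg _))

theorem CylOK.green (hn : 2 ≤ n) (hS : IsSphDomain S) (hW : CylOK S W M B) (s t : ℝ) :
    ∫ x, (W (s, x) * fL W (t, x) + ∑ i, fG i W (s, x) * fG i W (t, x)) ∂(nuS S) = 0 := by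
  have h := green_sphere hn hS (f := fun x => W (s, x)) (g := fun x => W (t, x)) (B := B)
    (fun x hx => contDiffAt_slice (p := (s, x)) (hW.smooth (s, x) hx))
    (fun x hx => contDiffAt_slice (p := (t, x)) (hW.smooth (t, x) hx))
    (hW.cont s) (hW.bdry s) (hW.homog s) (hW.homog t)
    (fun x hx h1 h2 => ⟨(hW.bound (s, x) hx h1 h2).1, (hW.slice_bound hS (p := (s, x)) hx h1 h2).1,
      hW.slice_bound hS (p := (t, x)) hx h1 h2⟩)
  rw [← h, nuS]
  apply setIntegral_congr_fun hS.measurable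
  intro x hx
  have hx' := S_sub_cone hS hx
  simp only
  rw [lap_slice_eq hS hW (p := (t, x)) hx']
  congr 1
  apply Finset.sum_congr rfl
  intro i _
  rw [fderiv_slice_apply (p := (t, x)) (hW.smooth (t, x) hx'),
    fderiv_slice_apply (p := (s, x)) (hW.smooth (s, x) hx')]
  rfl

theorem CylOK.green_shift (hn : 2 ≤ n) (hS : IsSphDomain S) (hW : CylOK S W M B) (a : ℝ) :
    ∫ p, W (p.1 + a, p.2) * fL W p ∂(muS S) =
      - ∑ i, ∫ p, fG i W (p.1 + a, p.2) * fG i W p ∂(muS S) := by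
  have hm := hS.measurable
  have i1 := (Good.mul_left ((hW.goodW hS).toBC.shift a) (hW.goodL hS)).integrable hm
  have i2 := fun i => (Good.mul_left ((hW.goodG hS i).toBC.shift a) (hW.goodG hS i)).integrable hm
  rw [← integral_finsetSum _ fun i _ => i2 i, eq_neg_iff_add_eq_zero, ← integral_add i1
    (integrable_finsetSum _ fun i _ => i2 i)]
  have i3 := i1.add (integrable_finsetSum Finset.univ fun i _ => i2 i)
  rw [muS] at i3 ⊢
  refine (integral_prod _ i3).trans ?_
  apply integral_eq_zero_of_ae
  exact Eventually.of_forall fun s => hW.green hn hS (s + a) s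

theorem CylOK.green1 (hn : 2 ≤ n) (hS : IsSphDomain S) (hW : CylOK S W M B) (a : ℝ) :
    ∫ p, fA W (p.1 + a, p.2) * fL W p ∂(muS S) =
      - ∑ i, ∫ p, fH i W (p.1 + a, p.2) * fG i W p ∂(muS S) := by
  have hm := hS.measurable
  have h1 := Good.hasDeriv_shift hm (hW.goodW hS).toBC (hW.goodA hS).toBC (hW.goodL hS)
    (hW.dW hS) a
  have h2 := (HasDerivAt.fun_sum (u := Finset.univ) fun i _ =>
    Good.hasDeriv_shift hm (hW.goodG hS i).toBC (hW.goodH hS i).toBC (hW.goodG hS i)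
    (hW.dG hS i) a).neg
  have he : (fun a => ∫ p, W (p.1 + a, p.2) * fL W p ∂(muS S)) = _ :=
    funext fun a => hW.green_shift hn hS a
  rw [he] at h1
  exact h1.unique h2

theorem CylOK.green2 (hn : 2 ≤ n) (hS : IsSphDomain S) (hW : CylOK S W M B) :
    ∫ p, fB W p * fL W p ∂(muS S) = ∑ i, ∫ p, fH i W p ^ 2 ∂(muS S) := by
  have hm := hS.measurable
  have h1 := Good.hasDeriv_shift hm (hW.goodA hS).toBC (hW.goodB hS).toBC (hW.goodL hS)
    (hW.dA hS) 0
  have hK : ∀ i, HasDerivAt (fun a => ∫ p, fH i W (p.1 + a, p.2) * fG i W p ∂(muS S))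
      (-∫ p, fH i W p ^ 2 ∂(muS S)) 0 := by
    intro i
    have h3 := Good.hasDeriv_shift hm (hW.goodG hS i).toBC (hW.goodH hS i).toBC (hW.goodH hS i)
      (hW.dG hS i) (-0)
    have h4 := HasDerivAt.comp (0:ℝ) h3 (hasDerivAt_neg (0:ℝ))
    have h5 : (fun a => ∫ p, fH i W (p.1 + a, p.2) * fG i W p ∂(muS S)) =
        (fun a => ∫ p, fG i W (p.1 + a, p.2) * fH i W p ∂(muS S)) ∘ Neg.neg := by
      funext a
      have := integral_shift (S := S) (fun p => fH i W (p.1 + a, p.2) * fG i W p) (-a)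
      rw [← this]
      simp only [Function.comp, neg_add_cancel_right]
      apply integral_congr_ae
      exact Eventually.of_forall fun p => mul_comm _ _
    rw [h5]
    refine h4.congr_deriv ?_
    simp [pow_two]
  have h2 := (HasDerivAt.fun_sum (u := Finset.univ) fun i _ => hK i).neg
  have he : (fun a => ∫ p, fA W (p.1 + a, p.2) * fL W p ∂(muS S)) = _ :=
    funext fun a => hW.green1 hn hS a
  rw [he] at h1
  have := h1.unique h2
  simpa using this

theorem CylOK.final (hn : 2 ≤ n) (hS : IsSphDomain S) (hW : CylOK S W M B) (c γ : ℝ) :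
    ∫ p, (fL W p + fB W p + c * fA W p - γ * W p) ^ 2 ∂(muS S) =
      ∫ p, (- fL W p + γ * W p) ^ 2 ∂(muS S) +
      ∫ p, (fB W p ^ 2 + 2 * ∑ i, fH i W p ^ 2 + (c ^ 2 + 2 * γ) * fA W p ^ 2) ∂(muS S) := by
  have hm := hS.measurable
  have gW := hW.goodW hS
  have gA := hW.goodA hS
  have gB := hW.goodB hS
  have gL := hW.goodL hS
  have gG := hW.goodG hS
  have gH := hW.goodH hS
  have gHs : Good S M (fun p => ∑ i, fH i W p ^ 2) := Good.sum _ fun i => (gH i).sq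
  have z1 : ∫ p, 2 * (fA W p * fB W p) ∂(muS S) = 0 :=
    Good.ftc hm gA.sq ((gA.mul gB).const_mul 2) fun p hp =>
      ((hW.dA hS p hp).pow 2).congr_deriv (by push_cast; ring)
  have z2 : ∫ p, (fB W p * W p + fA W p * fA W p) ∂(muS S) = 0 :=
    Good.ftc hm (gA.mul gW) ((gB.mul gW).add (gA.mul gA)) fun p hp =>
      ((hW.dA hS p hp).mul (hW.dW hS p hp))
  have z3 : ∫ p, 2 * (fA W p * W p) ∂(muS S) = 0 :=
    Good.ftc hm gW.sq ((gA.mul gW).const_mul 2) fun p hp =>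
      ((hW.dW hS p hp).pow 2).congr_deriv (by push_cast; ring)
  have z4 : ∫ p, fA W p * fL W p ∂(muS S) = 0 := by
    have h := hW.green1 hn hS 0
    simp only [add_zero, Prod.mk.eta] at h
    rw [h, neg_eq_zero]
    apply Finset.sum_eq_zero
    intro i _
    have h2 : ∫ p, 2 * (fH i W p * fG i W p) ∂(muS S) = 0 :=
      Good.ftc hm (gG i).sq (((gH i).mul (gG i)).const_mul 2) fun p hp =>
        ((hW.dG hS i p hp).pow 2).congr_deriv (by push_cast; ring)
    rw [integral_const_mul] at h2
    linarith
  have z5 : ∫ p, (fB W p * fL W p + (-1) * ∑ i, fH i W p ^ 2) ∂(muS S) = 0 := by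
    rw [integral_add ((gB.mul gL).integrable hm) ((gHs.const_mul (-1)).integrable hm),
      integral_const_mul, integral_finsetSum _ fun i _ => ((gH i).sq).integrable hm,
      hW.green2 hn hS]
    ring
  have gQ : Good S M (fun p => (- fL W p + γ * W p) ^ 2) := by
    have := ((gL.const_mul (-1)).add (gW.const_mul γ)).sq
    simpa using this
  have gP : Good S M (fun p => fB W p ^ 2 + 2 * ∑ i, fH i W p ^ 2 + (c ^ 2 + 2 * γ) * fA W p ^ 2) :=
    (gB.sq.add (gHs.const_mul 2)).add (gA.sq.const_mul _)
  have y1 := ((gA.mul gB).const_mul 2).const_mul c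
  have y2 := ((gB.mul gW).add (gA.mul gA)).const_mul (-2 * γ)
  have y3 := ((gA.mul gW).const_mul 2).const_mul (-c * γ)
  have y4 := (gA.mul gL).const_mul (2 * c)
  have y5 := ((gB.mul gL).add (gHs.const_mul (-1))).const_mul 2
  have e : ∀ p, (fL W p + fB W p + c * fA W p - γ * W p) ^ 2 =
      ((- fL W p + γ * W p) ^ 2 +
      (fB W p ^ 2 + 2 * ∑ i, fH i W p ^ 2 + (c ^ 2 + 2 * γ) * fA W p ^ 2)) +
      (((c * (2 * (fA W p * fB W p)) + (-2 * γ) * (fB W p * W p + fA W p * fA W p)) +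
      ((-c * γ) * (2 * (fA W p * W p)) + (2 * c) * (fA W p * fL W p))) +
      2 * (fB W p * fL W p + (-1) * ∑ i, fH i W p ^ 2)) := by
    intro p; ring
  simp only [e]
  rw [integral_add ((gQ.add gP).integrable hm)
      ((((y1.add y2).add (y3.add y4)).add y5).integrable hm),
    integral_add (gQ.integrable hm) (gP.integrable hm),
    integral_add (((y1.add y2).add (y3.add y4)).integrable hm) (y5.integrable hm),
    integral_add ((y1.add y2).integrable hm) ((y3.add y4).integrable hm),
    integral_add (y1.integrable hm) (y2.integrable hm),
    integral_add (y3.integrable hm) (y4.integrable hm)]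
  simp only [integral_const_mul c, integral_const_mul (-2 * γ), integral_const_mul (-c * γ),
    integral_const_mul (2 * c), z1, z2, z3, z4, mul_zero]
  rw [integral_const_mul 2 (fun p => fB W p * fL W p + (-1) * ∑ i, fH i W p ^ 2), z5]
  ring
end cyl

open MeasureTheory Metric Set Filter
open scoped RealInnerProductSpace Topology

section fin
variable {n : ℕ} {S : Set (EuclideanSpace ℝ (Fin n))} {M B : ℝ}
  {W : ℝ × EuclideanSpace ℝ (Fin n) → ℝ}

theorem CylOK.homogA (hW : CylOK S W M B) {r : ℝ} (hr : 0 < r) (s : ℝ)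
    {x : EuclideanSpace ℝ (Fin n)} (hx : x ∈ coneOf S) : fA W (s, r • x) = fA W (s, x) := by
  have h1 := hasDerivAt_slice (diff_of_contDiffAt (hW.smooth (s, x) hx))
  have h2 := hasDerivAt_slice (diff_of_contDiffAt (hW.smooth (s, r • x) ((coneOf_smul hr).2 hx)))
  have he : (fun t => W (t, (s, r • x).2)) = fun t => W (t, (s, x).2) :=
    funext fun t => hW.homog t r hr x
  rw [he] at h2
  exact h2.unique h1

theorem CylOK.homogB (hW : CylOK S W M B) {r : ℝ} (hr : 0 < r) (s : ℝ)
    {x : EuclideanSpace ℝ (Fin n)} (hx : x ∈ coneOf S) : fB W (s, r • x) = fB W (s, x) := by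
  have h1 := hasDerivAt_d1 (hW.smooth (s, x) hx) (1, 0)
  have h2 := hasDerivAt_d1 (hW.smooth (s, r • x) ((coneOf_smul hr).2 hx)) (1, 0)
  have he : (fun t => fderiv ℝ W (t, (s, r • x).2) (1, 0)) =
      fun t => fderiv ℝ W (t, (s, x).2) (1, 0) :=
    funext fun t => hW.homogA hr t hx
  rw [he] at h2
  exact h2.unique h1

theorem CylOK.homogL (hS : IsSphDomain S) (hW : CylOK S W M B) {r : ℝ} (hr : 0 < r) (s : ℝ)
    {x : EuclideanSpace ℝ (Fin n)} (hx : x ∈ coneOf S) :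
    r ^ 2 * fL W (s, r • x) = fL W (s, x) := by
  rw [← lap_slice_eq hS hW (p := (s, x)) hx,
    ← lap_slice_eq hS hW (p := (s, r • x)) ((coneOf_smul hr).2 hx)]
  exact lap_homog (hW.homog s) hr x
end fin

noncomputable section

/-- Lemma 1 of the paper, Emden–Fowler transform: if
`u(x) = |x|^{(4-n-α)/2} w(-log|x|, x/|x|)` then the weighted `L²` norm of `u` and
of `Δu` on the cone are computed by integrals of `w` on the cylinder `ℝ × Σ`. -/
theorem emden_fowler_identities {n : ℕ} (hn : 2 ≤ n) (α : ℝ)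
    (S : Set (EuclideanSpace ℝ (Fin n))) (hS : IsSphDomain S)
    (u : EuclideanSpace ℝ (Fin n) → ℝ) (hu : NavierAdm (coneOf S) u)
    (w : ℝ × EuclideanSpace ℝ (Fin n) → ℝ)
    (hw : ∀ x : EuclideanSpace ℝ (Fin n), x ≠ 0 →
      u x = ‖x‖ ^ ((4 - (n : ℝ) - α) / 2) * w (-Real.log ‖x‖, ‖x‖⁻¹ • x)) :
    (∫ x in coneOf S, ‖x‖ ^ (α - 4) * (u x) ^ 2) =
      (∫ p in (Set.univ ×ˢ S), (w p) ^ 2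
        ∂((volume : Measure ℝ).prod (sphMeasure n))) ∧
    (∫ x in coneOf S, ‖x‖ ^ α * (lap u x) ^ 2) =
      (∫ p in (Set.univ ×ˢ S),
          (- sphLap (fun y => w (p.1, y)) p.2 + gam n α * w p) ^ 2
        ∂((volume : Measure ℝ).prod (sphMeasure n))) +
      (∫ p in (Set.univ ×ˢ S),
          ((wss w p) ^ 2 + 2 * sphGradNormSq (fun y => ws w (p.1, y)) p.2
            + 2 * gbar n α * (ws w p) ^ 2)
        ∂((volume : Measure ℝ).prod (sphMeasure n))) := by
  obtain ⟨M, B, hW⟩ := ext_ok hS hu hw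
  have hm := hS.measurable
  have ho := hS.isOpen_cone
  have hκ2 : ∀ x : EuclideanSpace ℝ (Fin n), x ≠ 0 →
      ‖x‖ ^ (α - 4) * (‖x‖ ^ ((4 - (n : ℝ) - α) / 2)) ^ 2 = (‖x‖ ^ n)⁻¹ := by
    intro x hx
    have hx0 : 0 < ‖x‖ := norm_pos_iff.2 hx
    rw [← Real.rpow_natCast, ← Real.rpow_mul hx0.le, ← Real.rpow_add hx0, ← Real.rpow_natCast,
      ← Real.rpow_neg hx0.le]
    congr 1
    push_cast
    ring
  constructor
  · rw [← integral_cyl hn hm ho.measurableSet (fun p => w p ^ 2)]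
    apply setIntegral_congr_fun ho.measurableSet
    intro x hx
    simp only
    rw [hw x hx.1, mul_pow, ← mul_assoc, hκ2 x hx.1]
  · have hfin := hW.final hn hS (α - 2) (gam n α)
    rw [muS_eq] at hfin
    set W : ℝ × EuclideanSpace ℝ (Fin n) → ℝ := fun p => w (p.1, ‖p.2‖⁻¹ • p.2) with hWdef
    have hset : MeasurableSet ((Set.univ : Set ℝ) ×ˢ S) := MeasurableSet.univ.prod hm
    have e1 : ∫ x in coneOf S, ‖x‖ ^ α * (lap u x) ^ 2 =
        ∫ p in (Set.univ ×ˢ S), (fL W p + fB W p + (α - 2) * fA W p - gam n α * W p) ^ 2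
          ∂((volume : Measure ℝ).prod (sphMeasure n)) := by
      rw [← integral_cyl hn hm ho.measurableSet
        (fun p => (fL W p + fB W p + (α - 2) * fA W p - gam n α * W p) ^ 2)]
      apply setIntegral_congr_fun ho.measurableSet
      intro x hx
      have hx0 : 0 < ‖x‖ := norm_pos_iff.2 hx.1
      have hr : 0 < ‖x‖⁻¹ := inv_pos.2 hx0
      have hL := lap_formula (κ := (4 - (n : ℝ) - α) / 2) hS
        (fun y hy => (hu.1.mono subset_closure).contDiffAt (ho.mem_nhds hy)) hW
        (fun y hy => hw y hy.1) hx
      simp only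
      rw [hW.homogA hr _ hx, hW.homogB hr _ hx]
      have hWh : W (-Real.log ‖x‖, ‖x‖⁻¹ • x) = W (-Real.log ‖x‖, x) := hW.homog _ _ hr x
      have hL2 : fL W (-Real.log ‖x‖, ‖x‖⁻¹ • x) = ‖x‖ ^ 2 * fL W (-Real.log ‖x‖, x) := by
        rw [← hW.homogL hS hr _ hx, ← mul_assoc, ← mul_pow, mul_inv_cancel₀ hx0.ne', one_pow,
          one_mul]
      rw [hWh, hL2, ← hκ2 x hx.1]
      have hlap : lap u x = (‖x‖ ^ 2)⁻¹ * (‖x‖ ^ 2 * lap u x) := by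
        field_simp
      have hα : ‖x‖ ^ α = ‖x‖ ^ (α - 4) * ‖x‖ ^ 4 := by
        rw [← Real.rpow_natCast, ← Real.rpow_add hx0]
        congr 1
        push_cast
        ring
      rw [hlap, hL, hα]
      simp only [gam]
      generalize W (-Real.log ‖x‖, x) = a0
      field_simp
      ring
    have e2 : ∫ p in (Set.univ ×ˢ S),
          (- sphLap (fun y => w (p.1, y)) p.2 + gam n α * w p) ^ 2
        ∂((volume : Measure ℝ).prod (sphMeasure n)) =
        ∫ p in (Set.univ ×ˢ S), (- fL W p + gam n α * W p) ^ 2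
          ∂((volume : Measure ℝ).prod (sphMeasure n)) := by
      apply setIntegral_congr_fun hset
      intro p hp
      have hWp : W p = w p := by
        simp only [W]
        rw [norm_of_mem hS hp.2, inv_one, one_smul]
      simp only
      rw [sphLap_eq hS hW hp.2, hWp]
    have e3 : ∫ p in (Set.univ ×ˢ S),
          ((wss w p) ^ 2 + 2 * sphGradNormSq (fun y => ws w (p.1, y)) p.2
            + 2 * gbar n α * (ws w p) ^ 2)
        ∂((volume : Measure ℝ).prod (sphMeasure n)) =
        ∫ p in (Set.univ ×ˢ S), (fB W p ^ 2 + 2 * ∑ i, fH i W p ^ 2 +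
          ((α - 2) ^ 2 + 2 * gam n α) * fA W p ^ 2)
          ∂((volume : Measure ℝ).prod (sphMeasure n)) := by
      apply setIntegral_congr_fun hset
      intro p hp
      simp only
      rw [ws_eq hS hW hp.2, wss_eq hS hW hp.2, sphGrad_eq hS hW hp.2]
      simp only [gbar, gam, W]
      ring
    rw [e1, e2, e3]
    exact hfin

end
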